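/- Let k and m be integers with 3 ≤ m ≤ k, and let h_m ≥ h_{m+1} ≥ … ≥ h_k > 0 be integers. Then there exists a realization LS(h_m^m h_{m+1} … h_k), i.e. a realization of the partition consisting of m parts equal to h_m followed by the parts h_{m+1}, …, h_k. -/

import Mathlib

/-- A latin square of order `n`: an `n × n` array with symbols from a set of
size `n` (encoded as `Fin n`) such that every symbol occurs exactly once in
every row and every column. -/
def IsLatinSquare {n : ℕ} (L : Fin n → Fin n → Fin n) : Prop :=
  (∀ i, Function.Bijective fun j => L i j) ∧ (∀ j, Function.Bijective fun i => L i j)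

/-- `L` has pairwise disjoint subsquares of orders `h 0, …, h (k-1)`:
for each `i` there are sets `R i` of rows, `C i` of columns and `S i` of
symbols, each of size `h i`, pairwise disjoint (no shared rows, columns or
symbols), such that the subarray on rows `R i` and columns `C i` only uses
the symbols `S i` (given that `L` is a latin square, this subarray is then
itself a latin square of order `h i` on the symbol set `S i`). -/
def HasDisjointSubsquares {n k : ℕ} (L : Fin n → Fin n → Fin n) (h : Fin k → ℕ) : Prop :=
  ∃ R C S : Fin k → Finset (Fin n),
    (∀ i, (R i).card = h i) ∧ (∀ i, (C i).card = h i) ∧ (∀ i, (S i).card = h i) ∧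
    (∀ i j, i ≠ j → Disjoint (R i) (R j)) ∧
    (∀ i j, i ≠ j → Disjoint (C i) (C j)) ∧
    (∀ i j, i ≠ j → Disjoint (S i) (S j)) ∧
    (∀ i, ∀ x ∈ R i, ∀ y ∈ C i, L x y ∈ S i)

/-- An incomplete latin square `ILS(n; h_1 … h_k)`: a latin square of order `n`
with pairwise disjoint subsquares of orders `h_1, …, h_k`. -/
def HasILS (n : ℕ) {k : ℕ} (h : Fin k → ℕ) : Prop :=
  ∃ L : Fin n → Fin n → Fin n, IsLatinSquare L ∧ HasDisjointSubsquares L h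

/-- A realization of the partition `(h_1 … h_k)` of `n = h_1 + … + h_k`:
a latin square of order `n` with pairwise disjoint subsquares of orders
`h_1, …, h_k`. -/
def HasRealization {k : ℕ} (h : Fin k → ℕ) : Prop :=
  HasILS (∑ i, h i) h

/-! ### Proper colourings of regular bipartite multigraphs -/

/-- A finite regular bipartite multigraph with edge set `S` and end maps `α`, `β` is properly
edge-coloured by `N` colours, where `N` is the degree. -/
theorem exists_proper_colouring {E P Q : Type*} [DecidableEq E] [DecidableEq P] [DecidableEq Q]
    (α : E → P) (β : E → Q) (N : ℕ) : ∀ S : Finset E,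
    (∀ e ∈ S, (S.filter fun e' => α e' = α e).card = N) →
    (∀ e ∈ S, (S.filter fun e' => β e' = β e).card = N) →
    ∃ c : E → ℕ, (∀ e ∈ S, c e < N) ∧
      (∀ e ∈ S, ∀ e' ∈ S, α e = α e' → c e = c e' → e = e') ∧
      (∀ e ∈ S, ∀ e' ∈ S, β e = β e' → c e = c e' → e = e') := by
  induction N with
  | zero =>
    intro S hα hβ
    have : ∀ e, e ∉ S := fun e he => by
      have h := Finset.card_eq_zero.1 (hα e he)
      have : e ∈ S.filter fun e' => α e' = α e := by simp [he]
      simp [h] at this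
    exact ⟨fun _ => 0, fun e he => absurd he (this e), fun e he => absurd he (this e),
      fun e he => absurd he (this e)⟩
  | succ N ih =>
    intro S hα hβ
    -- the Hall condition holds by double counting
    have hcount : ∀ A : Finset P, A ⊆ S.image α →
        (S.filter fun e => α e ∈ A).card = A.card * (N + 1) := by
      intro A hA
      rw [Finset.card_eq_sum_card_fiberwise (f := α) (t := A) (by intro e he; simp at he; exact he.2)]
      rw [Finset.sum_const_nat]
      intro p hp
      obtain ⟨e, he, rfl⟩ := Finset.mem_image.1 (hA hp)
      rw [← hα e he]
      congr 1
      ext e'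
      simp only [Finset.mem_filter]
      constructor
      · rintro ⟨⟨h1, h2⟩, h3⟩; exact ⟨h1, h3⟩
      · rintro ⟨h1, h3⟩; exact ⟨⟨h1, h3 ▸ hp⟩, h3⟩
    have hcount' : ∀ A : Finset Q, A ⊆ S.image β →
        (S.filter fun e => β e ∈ A).card = A.card * (N + 1) := by
      intro A hA
      rw [Finset.card_eq_sum_card_fiberwise (f := β) (t := A) (by intro e he; simp at he; exact he.2)]
      rw [Finset.sum_const_nat]
      intro p hp
      obtain ⟨e, he, rfl⟩ := Finset.mem_image.1 (hA hp)
      rw [← hβ e he]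
      congr 1
      ext e'
      simp only [Finset.mem_filter]
      constructor
      · rintro ⟨⟨h1, h2⟩, h3⟩; exact ⟨h1, h3⟩
      · rintro ⟨h1, h3⟩; exact ⟨⟨h1, h3 ▸ hp⟩, h3⟩
    let t : (S.image α) → Finset Q := fun p => (S.filter fun e => α e = p.1).image β
    have hall : ∀ A : Finset (S.image α), A.card ≤ (A.biUnion t).card := by
      intro A
      have h1 := hcount (A.map (Function.Embedding.subtype _)) (by
        intro p hp; simp at hp; obtain ⟨h, -⟩ := hp; simpa using h)
      have h2 := hcount' (A.biUnion t) (by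
        intro q hq
        simp only [Finset.mem_biUnion, t, Finset.mem_image, Finset.mem_filter] at hq
        obtain ⟨p, hp, e, ⟨he, -⟩, rfl⟩ := hq
        exact Finset.mem_image_of_mem _ he)
      have h3 : (S.filter fun e => α e ∈ A.map (Function.Embedding.subtype _)) ⊆
          S.filter fun e => β e ∈ A.biUnion t := by
        intro e he
        simp only [Finset.mem_filter, Finset.mem_map, Function.Embedding.subtype_apply] at he
        obtain ⟨he, p, hp, hpe⟩ := he
        simp only [Finset.mem_filter, Finset.mem_biUnion, t, Finset.mem_image]
        exact ⟨he, p, hp, e, ⟨he, hpe.symm⟩, rfl⟩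
      have h4 := Finset.card_le_card h3
      rw [h1, h2, Finset.card_map] at h4
      exact Nat.le_of_mul_le_mul_right h4 (Nat.succ_pos N)
    obtain ⟨f, hf, hft⟩ := (Finset.all_card_le_biUnion_card_iff_exists_injective t).1 hall
    have hedge : ∀ p : S.image α, ∃ e ∈ S, α e = p.1 ∧ β e = f p := by
      intro p
      have := hft p
      simp only [t, Finset.mem_image, Finset.mem_filter] at this
      obtain ⟨e, ⟨he, h1⟩, h2⟩ := this
      exact ⟨e, he, h1, h2⟩
    choose g hgS hgα hgβ using hedge
    have hcards : (S.image α).card = (S.image β).card := by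
      have h1 := hcount _ (Finset.Subset.refl (S.image α))
      have h2 := hcount' _ (Finset.Subset.refl (S.image β))
      have h3 : (S.filter fun e => α e ∈ S.image α) = S.filter fun e => β e ∈ S.image β := by
        apply Finset.filter_congr
        intro e he
        simp only [Finset.mem_image_of_mem _ he]
      rw [h3, h2] at h1
      exact (Nat.eq_of_mul_eq_mul_right (Nat.succ_pos N) h1).symm
    have hsurj : ∀ q ∈ S.image β, ∃ p, f p = q := by
      have h1 : Finset.univ.image f ⊆ S.image β := by
        intro q hq
        simp only [Finset.mem_image, Finset.mem_univ, true_and] at hq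
        obtain ⟨p, rfl⟩ := hq
        rw [← hgβ p]
        exact Finset.mem_image_of_mem _ (hgS p)
      have h2 := Finset.eq_of_subset_of_card_le h1 (by
        rw [Finset.card_image_of_injective _ hf, ← hcards]; simp)
      intro q hq
      rw [← h2] at hq
      simpa using hq
    let M : Finset E := Finset.univ.image g
    have hMS : M ⊆ S := by
      intro e he
      simp only [M, Finset.mem_image, Finset.mem_univ, true_and] at he
      obtain ⟨p, rfl⟩ := he
      exact hgS p
    have hMα : ∀ e ∈ M, ∀ e' ∈ M, α e = α e' → e = e' := by
      intro e he e' he' h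
      simp only [M, Finset.mem_image, Finset.mem_univ, true_and] at he he'
      obtain ⟨p, rfl⟩ := he
      obtain ⟨p', rfl⟩ := he'
      rw [hgα, hgα] at h
      rw [Subtype.ext h]
    have hMβ : ∀ e ∈ M, ∀ e' ∈ M, β e = β e' → e = e' := by
      intro e he e' he' h
      simp only [M, Finset.mem_image, Finset.mem_univ, true_and] at he he'
      obtain ⟨p, rfl⟩ := he
      obtain ⟨p', rfl⟩ := he'
      rw [hgβ, hgβ] at h
      rw [hf h]
    have hMαex : ∀ e ∈ S, ∃ e' ∈ M, α e' = α e := fun e he =>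
      ⟨g ⟨α e, Finset.mem_image_of_mem _ he⟩, Finset.mem_image_of_mem _ (Finset.mem_univ _), hgα _⟩
    have hMβex : ∀ e ∈ S, ∃ e' ∈ M, β e' = β e := by
      intro e he
      obtain ⟨p, hp⟩ := hsurj _ (Finset.mem_image_of_mem β he)
      exact ⟨g p, Finset.mem_image_of_mem _ (Finset.mem_univ _), (hgβ p).trans hp⟩
    obtain ⟨c, hc, hcα, hcβ⟩ := ih (S \ M)
      (by
        intro e he
        obtain ⟨heS, -⟩ := Finset.mem_sdiff.1 he
        obtain ⟨e', he', hee'⟩ := hMαex e heS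
        have h1 : ((S \ M).filter fun e' => α e' = α e) =
            (S.filter fun e' => α e' = α e).erase e' := by
          ext x
          simp only [Finset.mem_filter, Finset.mem_sdiff, Finset.mem_erase]
          constructor
          · rintro ⟨⟨h1, h2⟩, h3⟩
            exact ⟨fun h => h2 (h ▸ he'), h1, h3⟩
          · rintro ⟨h1, h2, h3⟩
            exact ⟨⟨h2, fun h => h1 (hMα _ h _ he' (h3.trans hee'.symm))⟩, h3⟩
        rw [h1, Finset.card_erase_of_mem (by simp [hMS he', hee']), hα e heS]
        rfl)
      (by
        intro e he
        obtain ⟨heS, -⟩ := Finset.mem_sdiff.1 he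
        obtain ⟨e', he', hee'⟩ := hMβex e heS
        have h1 : ((S \ M).filter fun e' => β e' = β e) =
            (S.filter fun e' => β e' = β e).erase e' := by
          ext x
          simp only [Finset.mem_filter, Finset.mem_sdiff, Finset.mem_erase]
          constructor
          · rintro ⟨⟨h1, h2⟩, h3⟩
            exact ⟨fun h => h2 (h ▸ he'), h1, h3⟩
          · rintro ⟨h1, h2, h3⟩
            exact ⟨⟨h2, fun h => h1 (hMβ _ h _ he' (h3.trans hee'.symm))⟩, h3⟩
        rw [h1, Finset.card_erase_of_mem (by simp [hMS he', hee']), hβ e heS]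
        rfl)
    refine ⟨fun e => if e ∈ M then N else c e, ?_, ?_, ?_⟩
    · intro e he
      by_cases h : e ∈ M
      · simp [h]
      · simp only [h, if_false]
        exact (hc e (Finset.mem_sdiff.2 ⟨he, h⟩)).trans (Nat.lt_succ_self N)
    · intro e he e' he' h1 h2
      by_cases h : e ∈ M <;> by_cases hM' : e' ∈ M <;> simp only [h, hM', if_true, if_false] at h2
      · exact hMα e h e' hM' h1
      · exact absurd h2 (hc e' (Finset.mem_sdiff.2 ⟨he', hM'⟩)).ne'
      · exact absurd h2 (hc e (Finset.mem_sdiff.2 ⟨he, h⟩)).ne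
      · exact hcα e (Finset.mem_sdiff.2 ⟨he, h⟩) e' (Finset.mem_sdiff.2 ⟨he', hM'⟩) h1 h2
    · intro e he e' he' h1 h2
      by_cases h : e ∈ M <;> by_cases hM' : e' ∈ M <;> simp only [h, hM', if_true, if_false] at h2
      · exact hMβ e h e' hM' h1
      · exact absurd h2 (hc e' (Finset.mem_sdiff.2 ⟨he', hM'⟩)).ne'
      · exact absurd h2 (hc e (Finset.mem_sdiff.2 ⟨he, h⟩)).ne
      · exact hcβ e (Finset.mem_sdiff.2 ⟨he, h⟩) e' (Finset.mem_sdiff.2 ⟨he', hM'⟩) h1 h2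

/-- A finite set of size `N * a` is cut into `a` blocks of size `N`, the elements of `G` being
placed first. -/
theorem exists_block_index {E : Type*} [DecidableEq E] (N a : ℕ) (F G : Finset E) (hG : G ⊆ F)
    (hF : F.card = N * a) :
    ∃ g : E → ℕ, (∀ e ∈ F, g e < a) ∧ (∀ i < a, (F.filter fun e => g e = i).card = N) ∧
      (∀ e ∈ G, g e * N < G.card) ∧ (∀ e ∈ F, e ∉ G → G.card < (g e + 1) * N) := by
  rcases Nat.eq_zero_or_pos N with rfl | hN
  · have hF0 : F = ∅ := by simpa using hF
    have hG0 : G = ∅ := by simpa [hF0] using hG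
    subst hF0; subst hG0
    exact ⟨fun _ => 0, by simp⟩
  let idx : E → ℕ := fun e =>
    if h : e ∈ G then (G.equivFin ⟨e, h⟩ : ℕ)
    else if h : e ∈ F \ G then G.card + ((F \ G).equivFin ⟨e, h⟩ : ℕ) else 0
  have hidxG : ∀ e ∈ G, idx e < G.card := by
    intro e he
    simp [idx, he]
  have hidxF : ∀ e ∈ F, e ∉ G → G.card ≤ idx e := by
    intro e he he'
    simp [idx, he, he']
  have hcard : G.card + (F \ G).card = N * a := by
    rw [← hF, add_comm, Finset.card_sdiff_add_card_eq_card hG]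
  have hlt : ∀ e ∈ F, idx e < N * a := by
    intro e he
    by_cases h : e ∈ G
    · have := hidxG e h; omega
    · have h' : e ∈ F \ G := Finset.mem_sdiff.2 ⟨he, h⟩
      have := ((F \ G).equivFin ⟨e, h'⟩).2
      simp only [idx, h, h', dif_neg, not_false_eq_true, dif_pos]
      omega
  have hinj : ∀ e ∈ F, ∀ e' ∈ F, idx e = idx e' → e = e' := by
    intro e he e' he' h
    by_cases h1 : e ∈ G <;> by_cases h2 : e' ∈ G
    · simp only [idx, h1, h2, dif_pos] at h
      simpa using (G.equivFin).injective (Fin.ext h)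
    · have := hidxG e h1; have := hidxF e' he' h2; omega
    · have := hidxG e' h2; have := hidxF e he h1; omega
    · have h1' : e ∈ F \ G := Finset.mem_sdiff.2 ⟨he, h1⟩
      have h2' : e' ∈ F \ G := Finset.mem_sdiff.2 ⟨he', h2⟩
      simp only [idx, h1, h2, h1', h2', dif_pos, dif_neg, not_false_eq_true, add_right_inj] at h
      simpa using ((F \ G).equivFin).injective (Fin.ext h)
  have himg : F.image idx = Finset.range (N * a) := by
    apply Finset.eq_of_subset_of_card_le
    · intro n hn
      obtain ⟨e, he, rfl⟩ := Finset.mem_image.1 hn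
      exact Finset.mem_range.2 (hlt e he)
    · rw [Finset.card_image_of_injOn (fun e he e' he' h => hinj e he e' he' h), hF]; simp
  refine ⟨fun e => idx e / N, ?_, ?_, ?_, ?_⟩
  · intro e he
    exact Nat.div_lt_of_lt_mul (hlt e he)
  · intro i hi
    have h1 : (F.filter fun e => idx e / N = i).image idx = Finset.Ico (i * N) (i * N + N) := by
      ext n
      simp only [Finset.mem_image, Finset.mem_filter, Finset.mem_Ico]
      have key : n / N = i ↔ i * N ≤ n ∧ n < i * N + N := by
        rw [Nat.div_eq_iff hN]
        omega
      constructor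
      · rintro ⟨e, ⟨he, h⟩, rfl⟩
        exact key.1 h
      · intro h
        have hn : n ∈ F.image idx := by
          rw [himg, Finset.mem_range]
          have : (i + 1) * N ≤ a * N := Nat.mul_le_mul_right _ hi
          nlinarith [h.2]
        obtain ⟨e, he, rfl⟩ := Finset.mem_image.1 hn
        exact ⟨e, ⟨he, key.2 h⟩, rfl⟩
    rw [← Finset.card_image_of_injOn (f := idx) (s := F.filter fun e => idx e / N = i), h1]
    · simp
    · intro e he e' he' h
      simp only [Finset.coe_filter, Set.mem_ofPred_eq] at he he'
      exact hinj e he.1 e' he'.1 h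
  · intro e he
    exact (Nat.div_mul_le_self _ _).trans_lt (hidxG e he)
  · intro e he he'
    exact (hidxF e he he').trans_lt (Nat.lt_mul_of_div_lt (Nat.lt_succ_self _) hN)

/-- A finite bipartite multigraph all of whose degrees are multiples of `N` splits into `N`
subgraphs with the same degrees divided by `N`; the edges of a set `G` are shared out as evenly as
possible at every vertex on the left. -/
theorem exists_balanced_colouring {E P Q : Type*} [DecidableEq E] [DecidableEq P] [DecidableEq Q]
    (N : ℕ) (S G : Finset E) (α : E → P) (β : E → Q) (a : P → ℕ) (b : Q → ℕ)
    (hα : ∀ p, (S.filter fun e => α e = p).card = N * a p)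
    (hβ : ∀ q, (S.filter fun e => β e = q).card = N * b q) :
    ∃ c : E → ℕ, (∀ e ∈ S, c e < N) ∧
      (∀ p, ∀ k < N, (S.filter fun e => α e = p ∧ c e = k).card = a p) ∧
      (∀ q, ∀ k < N, (S.filter fun e => β e = q ∧ c e = k).card = b q) ∧
      (∀ p, ∀ k < N,
        (S.filter fun e => α e = p ∧ e ∈ G).card / N ≤
          (S.filter fun e => α e = p ∧ e ∈ G ∧ c e = k).card ∧
        (S.filter fun e => α e = p ∧ e ∈ G ∧ c e = k).card ≤
          (S.filter fun e => α e = p ∧ e ∈ G).card / N +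
          if N ∣ (S.filter fun e => α e = p ∧ e ∈ G).card then 0 else 1) := by
  have hrefine : ∀ p, ∃ g : E → ℕ, (∀ e ∈ S.filter (fun e => α e = p), g e < a p) ∧
      (∀ i < a p, ((S.filter fun e => α e = p).filter fun e => g e = i).card = N) ∧
      (∀ e ∈ S.filter (fun e => α e = p ∧ e ∈ G),
        g e * N < (S.filter fun e => α e = p ∧ e ∈ G).card) ∧
      (∀ e ∈ S.filter (fun e => α e = p), e ∉ S.filter (fun e => α e = p ∧ e ∈ G) →
        (S.filter fun e => α e = p ∧ e ∈ G).card < (g e + 1) * N) := fun p =>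
    exists_block_index N (a p) _ _ (by
      intro e he
      simp only [Finset.mem_filter] at he ⊢
      exact ⟨he.1, he.2.1⟩) (hα p)
  have hrefine' : ∀ q, ∃ g : E → ℕ, (∀ e ∈ S.filter (fun e => β e = q), g e < b q) ∧
      (∀ i < b q, ((S.filter fun e => β e = q).filter fun e => g e = i).card = N) := by
    intro q
    obtain ⟨g, h1, h2, -⟩ := exists_block_index N (b q) _ ∅ (by simp) (hβ q)
    exact ⟨g, h1, h2⟩
  choose g hg1 hg2 hg3 hg4 using hrefine
  choose g' hg1' hg2' using hrefine'
  obtain ⟨c, hcN, hc1, hc2⟩ := exists_proper_colouring (fun e => (α e, g (α e) e))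
    (fun e => (β e, g' (β e) e)) N S
    (by
      intro e he
      rw [← hg2 (α e) (g (α e) e) (hg1 _ _ (by simp [he])), Finset.filter_filter]
      congr 1
      ext x
      simp only [Finset.mem_filter, Prod.mk.injEq]
      constructor
      · rintro ⟨h1, h2, h3⟩; rw [h2] at h3; exact ⟨h1, h2, h3⟩
      · rintro ⟨h1, h2, h3⟩; rw [h2]; exact ⟨h1, rfl, h3⟩)
    (by
      intro e he
      rw [← hg2' (β e) (g' (β e) e) (hg1' _ _ (by simp [he])), Finset.filter_filter]
      congr 1
      ext x
      simp only [Finset.mem_filter, Prod.mk.injEq]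
      constructor
      · rintro ⟨h1, h2, h3⟩; rw [h2] at h3; exact ⟨h1, h2, h3⟩
      · rintro ⟨h1, h2, h3⟩; rw [h2]; exact ⟨h1, rfl, h3⟩)
  -- every block meets every colour class
  have hsurj : ∀ p, ∀ i < a p, ∀ k < N, ∃ e ∈ S, α e = p ∧ g p e = i ∧ c e = k := by
    intro p i hi k hk
    have himg : ((S.filter fun e => α e = p).filter fun e => g p e = i).image c =
        Finset.range N := by
      apply Finset.eq_of_subset_of_card_le
      · intro n hn
        simp only [Finset.mem_image, Finset.mem_filter] at hn
        obtain ⟨e, ⟨⟨he, -⟩, -⟩, rfl⟩ := hn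
        exact Finset.mem_range.2 (hcN e he)
      · rw [Finset.card_image_of_injOn, hg2 p i hi]
        · simp
        · intro e he e' he' h
          simp only [Finset.coe_filter, Finset.mem_filter, Set.mem_ofPred_eq] at he he'
          obtain ⟨⟨he, rfl⟩, h1⟩ := he
          obtain ⟨⟨he', h2⟩, h3⟩ := he'
          exact hc1 e he e' he' (by simp [h1, h2, h3]) h
    have hk' := Finset.mem_range.2 hk
    rw [← himg] at hk'
    simp only [Finset.mem_image, Finset.mem_filter] at hk'
    obtain ⟨e, ⟨⟨he, h1⟩, h2⟩, h3⟩ := hk'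
    exact ⟨e, he, h1, h2, h3⟩
  have hsurj' : ∀ p, ∀ i < b p, ∀ k < N, ∃ e ∈ S, β e = p ∧ g' p e = i ∧ c e = k := by
    intro p i hi k hk
    have himg : ((S.filter fun e => β e = p).filter fun e => g' p e = i).image c =
        Finset.range N := by
      apply Finset.eq_of_subset_of_card_le
      · intro n hn
        simp only [Finset.mem_image, Finset.mem_filter] at hn
        obtain ⟨e, ⟨⟨he, -⟩, -⟩, rfl⟩ := hn
        exact Finset.mem_range.2 (hcN e he)
      · rw [Finset.card_image_of_injOn, hg2' p i hi]
        · simp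
        · intro e he e' he' h
          simp only [Finset.coe_filter, Finset.mem_filter, Set.mem_ofPred_eq] at he he'
          obtain ⟨⟨he, rfl⟩, h1⟩ := he
          obtain ⟨⟨he', h2⟩, h3⟩ := he'
          exact hc2 e he e' he' (by simp [h1, h2, h3]) h
    have hk' := Finset.mem_range.2 hk
    rw [← himg] at hk'
    simp only [Finset.mem_image, Finset.mem_filter] at hk'
    obtain ⟨e, ⟨⟨he, h1⟩, h2⟩, h3⟩ := hk'
    exact ⟨e, he, h1, h2, h3⟩
  have hginj : ∀ p k, Set.InjOn (g p) {e | e ∈ S ∧ α e = p ∧ c e = k} := by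
    rintro p k e ⟨he, rfl, h1⟩ e' ⟨he', h2, h3⟩ h
    exact hc1 e he e' he' (by simp [h2, h]) (h1.trans h3.symm)
  have hginj' : ∀ p k, Set.InjOn (g' p) {e | e ∈ S ∧ β e = p ∧ c e = k} := by
    rintro p k e ⟨he, rfl, h1⟩ e' ⟨he', h2, h3⟩ h
    exact hc2 e he e' he' (by simp [h2, h]) (h1.trans h3.symm)
  refine ⟨c, hcN, ?_, ?_, ?_⟩
  · intro p k hk
    rw [← Finset.card_range (a p), ← Finset.card_image_of_injOn (f := g p)
      (by intro e he e' he' h; exact hginj p k (by simpa using he) (by simpa using he') h)]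
    congr 1
    ext i
    simp only [Finset.mem_image, Finset.mem_filter, Finset.mem_range]
    constructor
    · rintro ⟨e, ⟨he, h1, h2⟩, rfl⟩
      exact hg1 p e (by simp [he, h1])
    · intro hi
      obtain ⟨e, he, h1, h2, h3⟩ := hsurj p i hi k hk
      exact ⟨e, ⟨he, h1, h3⟩, h2⟩
  · intro p k hk
    rw [← Finset.card_range (b p), ← Finset.card_image_of_injOn (f := g' p)
      (by intro e he e' he' h; exact hginj' p k (by simpa using he) (by simpa using he') h)]
    congr 1
    ext i
    simp only [Finset.mem_image, Finset.mem_filter, Finset.mem_range]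
    constructor
    · rintro ⟨e, ⟨he, h1, h2⟩, rfl⟩
      exact hg1' p e (by simp [he, h1])
    · intro hi
      obtain ⟨e, he, h1, h2, h3⟩ := hsurj' p i hi k hk
      exact ⟨e, ⟨he, h1, h3⟩, h2⟩
  · intro p k hk
    have hN : 0 < N := by omega
    have hinj : Set.InjOn (g p) (S.filter fun e => α e = p ∧ e ∈ G ∧ c e = k) := by
      intro e he e' he' h
      simp only [Finset.coe_filter, Set.mem_ofPred_eq] at he he'
      exact hginj p k ⟨he.1, he.2.1, he.2.2.2⟩ ⟨he'.1, he'.2.1, he'.2.2.2⟩ h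
    set n := (S.filter fun e => α e = p ∧ e ∈ G).card with hn
    have hle : n ≤ N * a p := by
      rw [← hα p]
      apply Finset.card_le_card
      intro e he
      simp only [Finset.mem_filter] at he ⊢
      exact ⟨he.1, he.2.1⟩
    rw [← Finset.card_image_of_injOn hinj]
    constructor
    · conv_lhs => rw [← Finset.card_range (n / N)]
      apply Finset.card_le_card
      intro i hi
      rw [Finset.mem_range] at hi
      have hiN : (i + 1) * N ≤ n := (Nat.mul_le_mul_right N hi).trans (Nat.div_mul_le_self n N)
      have hia : i < a p := by
        by_contra hcon
        have : N * a p ≤ N * i := Nat.mul_le_mul_left N (by omega)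
        nlinarith
      obtain ⟨e, he, h1, h2, h3⟩ := hsurj p i hia k hk
      refine Finset.mem_image.2 ⟨e, ?_, h2⟩
      by_contra hcon
      have h4 := hg4 p e (by simp [he, h1]) (by
        intro h
        apply hcon
        simp only [Finset.mem_filter] at h ⊢
        exact ⟨h.1, h.2.1, h.2.2, h3⟩)
      rw [h2] at h4
      omega
    · rw [← Finset.card_range (n / N + if N ∣ n then 0 else 1)]
      apply Finset.card_le_card
      intro i hi
      obtain ⟨e, he, rfl⟩ := Finset.mem_image.1 hi
      simp only [Finset.mem_filter] at he
      have h1 := hg3 p e (by simp [he.1, he.2.1, he.2.2.1])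
      rw [Finset.mem_range]
      rw [← hn] at h1
      have h2 := Nat.div_add_mod n N
      split_ifs with hd
      · obtain ⟨t, ht⟩ := hd
        rw [ht, mul_comm] at h1
        rw [add_zero, ht, Nat.mul_div_cancel_left t hN]
        exact Nat.lt_of_mul_lt_mul_left h1
      · have h3 := Nat.mod_lt n hN
        by_contra hcon
        have : N * (n / N + 1) ≤ N * g p e := Nat.mul_le_mul_left N (by omega)
        rw [mul_add, mul_one, mul_comm N (g p e)] at this
        omega

/-- Matrix form of `exists_balanced_colouring`, with one marked entry in each row. -/
theorem exists_balanced_decomposition {P Q : Type*} [Fintype P] [Fintype Q] [DecidableEq P]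
    [DecidableEq Q] (N : ℕ) (f : P → Q → ℕ) (a : P → ℕ) (b : Q → ℕ) (mark : P → Q)
    (ha : ∀ p, ∑ q, f p q = N * a p) (hb : ∀ q, ∑ p, f p q = N * b q) :
    ∃ g : Fin N → P → Q → ℕ, (∀ p q, ∑ k, g k p q = f p q) ∧
      (∀ k p, ∑ q, g k p q = a p) ∧ (∀ k q, ∑ p, g k p q = b q) ∧
      ∀ k p, f p (mark p) / N ≤ g k p (mark p) ∧
        g k p (mark p) ≤ f p (mark p) / N + if N ∣ f p (mark p) then 0 else 1 := by
  let E := Σ pq : P × Q, Fin (f pq.1 pq.2)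
  have hfib : ∀ p q, (Finset.univ.filter fun e : E => e.1 = (p, q)).card = f p q := by
    intro p q
    rw [← Fintype.card_subtype, Fintype.card_congr (Equiv.sigmaSubtype (p, q)), Fintype.card_fin]
  have hcell : ∀ (R : E → Prop) [DecidablePred R] p,
      (Finset.univ.filter fun e : E => e.1.1 = p ∧ R e).card =
        ∑ q, (Finset.univ.filter fun e : E => e.1 = (p, q) ∧ R e).card := by
    intro R _ p
    rw [Finset.card_eq_sum_card_fiberwise (f := fun e : E => e.1.2) (t := Finset.univ) (by simp)]
    refine Finset.sum_congr rfl fun q _ => ?_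
    rw [Finset.filter_filter]
    congr 1
    ext e
    simp only [Finset.mem_filter, Finset.mem_univ, true_and, Prod.ext_iff]
    tauto
  have hcell' : ∀ (R : E → Prop) [DecidablePred R] q,
      (Finset.univ.filter fun e : E => e.1.2 = q ∧ R e).card =
        ∑ p, (Finset.univ.filter fun e : E => e.1 = (p, q) ∧ R e).card := by
    intro R _ q
    rw [Finset.card_eq_sum_card_fiberwise (f := fun e : E => e.1.1) (t := Finset.univ) (by simp)]
    refine Finset.sum_congr rfl fun p _ => ?_
    rw [Finset.filter_filter]
    congr 1
    ext e
    simp only [Finset.mem_filter, Finset.mem_univ, true_and, Prod.ext_iff]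
    tauto
  obtain ⟨c, hc, h1, h2, h3⟩ := exists_balanced_colouring N (Finset.univ : Finset E)
    (Finset.univ.filter fun e : E => e.1.2 = mark e.1.1) (fun e => e.1.1) (fun e => e.1.2) a b
    (by
      intro p
      have := hcell (fun _ => True) p
      simp only [and_true, hfib] at this
      rw [this, ha])
    (by
      intro q
      have := hcell' (fun _ => True) q
      simp only [and_true, hfib] at this
      rw [this, hb])
  refine ⟨fun k p q => (Finset.univ.filter fun e : E => e.1 = (p, q) ∧ c e = k).card,
    ?_, ?_, ?_, ?_⟩
  · intro p q
    rw [← hfib p q]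
    rw [Finset.card_eq_sum_card_fiberwise (f := fun e : E => (⟨c e, hc e (Finset.mem_univ e)⟩ : Fin N))
      (t := Finset.univ) (by simp)]
    refine Finset.sum_congr rfl fun k _ => ?_
    simp only [Finset.filter_filter, Fin.ext_iff]
  · intro k p
    rw [← h1 p k k.2, hcell]
  · intro k q
    rw [← h2 q k k.2, hcell']
  · intro k p
    have h4 : ∀ e : E, (e.1.1 = p ∧ e ∈ Finset.univ.filter
        (fun e : E => e.1.2 = mark e.1.1) ∧ c e = k) ↔ (e.1 = (p, mark p) ∧ c e = k) := by
      intro e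
      simp only [Finset.mem_filter, Finset.mem_univ, true_and, Prod.ext_iff]
      constructor
      · rintro ⟨h, h', h''⟩; exact ⟨⟨h, by rw [h', h]⟩, h''⟩
      · rintro ⟨⟨h, h'⟩, h''⟩; exact ⟨h, by rw [h', h], h''⟩
    have h5 := h3 p k k.2
    have h6 : ∀ e : E, (e.1.1 = p ∧ e ∈ Finset.univ.filter
        (fun e : E => e.1.2 = mark e.1.1)) ↔ e.1 = (p, mark p) := by
      intro e
      simp only [Finset.mem_filter, Finset.mem_univ, true_and, Prod.ext_iff]
      constructor
      · rintro ⟨h, h'⟩; exact ⟨h, by rw [h', h]⟩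
      · rintro ⟨h, h'⟩; exact ⟨h, by rw [h', h]⟩
    simp only [h4, h6, hfib] at h5
    exact h5

/-! ### Outline squares -/

/-- An outline array for the part sizes `w`: `x i j l` counts the symbols of part `l` in the block
of rows of part `i` and columns of part `j`, the diagonal blocks using only symbols of their own
part. -/
def HasOutline {I : Type*} [Fintype I] (w : I → ℕ) : Prop :=
  ∃ x : I → I → I → ℕ, (∀ i j, ∑ l, x i j l = w i * w j) ∧ (∀ i l, ∑ j, x i j l = w i * w l) ∧
    (∀ j l, ∑ i, x i j l = w j * w l) ∧ ∀ i l, l ≠ i → x i i l = 0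

theorem HasOutline.congr {I I' : Type*} [Fintype I] [Fintype I'] {w : I → ℕ} (h : HasOutline w)
    (e : I' ≃ I) {w' : I' → ℕ} (hw : ∀ i, w' i = w (e i)) : HasOutline w' := by
  obtain ⟨x, h1, h2, h3, h4⟩ := h
  refine ⟨fun i j l => x (e i) (e j) (e l), ?_, ?_, ?_, ?_⟩
  · intro i j
    rw [e.sum_comp fun l => x (e i) (e j) l, h1, hw, hw]
  · intro i l
    rw [e.sum_comp fun j => x (e i) j (e l), h2, hw, hw]
  · intro j l
    rw [e.sum_comp fun i => x i (e j) (e l), h3, hw, hw]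
  · intro i l hl
    exact h4 _ _ (e.injective.ne hl)

/-- Splitting all the fibres of `key` simultaneously, the fibre over `i` into `w i` pieces. -/
theorem exists_fibre_splitting {E I P Q : Type*} [Fintype E] [DecidableEq E] [DecidableEq I]
    [DecidableEq P] [DecidableEq Q] (w : I → ℕ) (key : E → I) (α : E → P) (β : E → Q)
    (a : P → ℕ) (b : Q → ℕ)
    (hα : ∀ i p, (Finset.univ.filter fun e => key e = i ∧ α e = p).card = w i * a p)
    (hβ : ∀ i q, (Finset.univ.filter fun e => key e = i ∧ β e = q).card = w i * b q) :
    ∃ ρ : E → Σ i, Fin (w i), (∀ e, (ρ e).1 = key e) ∧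
      (∀ s p, (Finset.univ.filter fun e => ρ e = s ∧ α e = p).card = a p) ∧
      (∀ s q, (Finset.univ.filter fun e => ρ e = s ∧ β e = q).card = b q) := by
  have hsplit : ∀ i, ∃ c : E → ℕ, (∀ e ∈ Finset.univ.filter (fun e => key e = i), c e < w i) ∧
      (∀ p, ∀ k < w i, ((Finset.univ.filter fun e => key e = i).filter
        fun e => α e = p ∧ c e = k).card = a p) ∧
      (∀ q, ∀ k < w i, ((Finset.univ.filter fun e => key e = i).filter
        fun e => β e = q ∧ c e = k).card = b q) := by
    intro i
    obtain ⟨c, h1, h2, h3, -⟩ := exists_balanced_colouring (w i)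
      (Finset.univ.filter fun e => key e = i) ∅ α β a b
      (by intro p; rw [Finset.filter_filter, hα]) (by intro p; rw [Finset.filter_filter, hβ])
    exact ⟨c, h1, h2, h3⟩
  choose c hc h1 h2 using hsplit
  have hρ : ∀ (i : I) (k : Fin (w i)) (e : E),
      ((⟨key e, ⟨c (key e) e, hc _ e (by simp)⟩⟩ : Σ i, Fin (w i)) = ⟨i, k⟩) ↔
        key e = i ∧ c i e = k := by
    intro i k e
    constructor
    · intro h
      have hi : key e = i := congrArg Sigma.fst h
      subst hi
      simpa [Fin.ext_iff] using h
    · rintro ⟨rfl, h⟩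
      simpa [Fin.ext_iff] using h
  refine ⟨fun e => ⟨key e, ⟨c (key e) e, hc _ e (by simp)⟩⟩, fun e => rfl, ?_, ?_⟩
  · rintro ⟨i, k⟩ p
    rw [← h1 i p k k.2, Finset.filter_filter]
    congr 1
    ext e
    simp only [Finset.mem_filter, Finset.mem_univ, true_and, hρ]
    tauto
  · rintro ⟨i, k⟩ p
    rw [← h2 i p k k.2, Finset.filter_filter]
    congr 1
    ext e
    simp only [Finset.mem_filter, Finset.mem_univ, true_and, hρ]
    tauto

/-- Every outline array is obtained by amalgamating a latin square. -/
theorem HasOutline.hasRealization {k : ℕ} {h : Fin k → ℕ} (ho : HasOutline h) :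
    HasRealization h := by
  obtain ⟨x, hx1, hx2, hx3, hx4⟩ := ho
  let V := Σ i, Fin (h i)
  let E := Σ t : Fin k × Fin k × Fin k, Fin (x t.1 t.2.1 t.2.2)
  have hfib : ∀ t, (Finset.univ.filter fun e : E => e.1 = t).card = x t.1 t.2.1 t.2.2 := by
    intro t
    rw [← Fintype.card_subtype, Fintype.card_congr (Equiv.sigmaSubtype t), Fintype.card_fin]
  have c1 : ∀ i j, (Finset.univ.filter fun e : E => e.1.1 = i ∧ e.1.2.1 = j).card = h i * h j := by
    intro i j
    rw [← hx1 i j, Finset.card_eq_sum_card_fiberwise (f := fun e : E => e.1.2.2)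
      (t := Finset.univ) (by simp)]
    refine Finset.sum_congr rfl fun l _ => ?_
    rw [← hfib (i, j, l), Finset.filter_filter]
    congr 1
    ext e
    simp only [Finset.mem_filter, Finset.mem_univ, true_and, Prod.ext_iff, and_assoc]
  have c2 : ∀ i l, (Finset.univ.filter fun e : E => e.1.1 = i ∧ e.1.2.2 = l).card = h i * h l := by
    intro i l
    rw [← hx2 i l, Finset.card_eq_sum_card_fiberwise (f := fun e : E => e.1.2.1)
      (t := Finset.univ) (by simp)]
    refine Finset.sum_congr rfl fun j _ => ?_
    rw [← hfib (i, j, l), Finset.filter_filter]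
    congr 1
    ext e
    simp only [Finset.mem_filter, Finset.mem_univ, true_and, Prod.ext_iff]
    tauto
  have c3 : ∀ j l, (Finset.univ.filter fun e : E => e.1.2.1 = j ∧ e.1.2.2 = l).card = h j * h l := by
    intro j l
    rw [← hx3 j l, Finset.card_eq_sum_card_fiberwise (f := fun e : E => e.1.1)
      (t := Finset.univ) (by simp)]
    refine Finset.sum_congr rfl fun i _ => ?_
    rw [← hfib (i, j, l), Finset.filter_filter]
    congr 1
    ext e
    simp only [Finset.mem_filter, Finset.mem_univ, true_and, Prod.ext_iff]
    tauto
  obtain ⟨ρ, hρ, r1, r2⟩ := exists_fibre_splitting h (fun e : E => e.1.1) (fun e => e.1.2.1)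
    (fun e => e.1.2.2) h h c1 c2
  obtain ⟨γ, hγ, g1, g2⟩ := exists_fibre_splitting h (fun e : E => e.1.2.1) ρ
    (fun e => e.1.2.2) (fun _ => 1) h
    (by intro j s; rw [mul_one, ← r1 s j]; simp only [and_comm]) c3
  obtain ⟨σ, hσ, s1, s2⟩ := exists_fibre_splitting h (fun e : E => e.1.2.2) ρ γ
    (fun _ => 1) (fun _ => 1)
    (by intro l s; rw [mul_one, ← r2 s l]; simp only [and_comm])
    (by intro l s; rw [mul_one, ← g2 s l]; simp only [and_comm])
  have huniq : ∀ u v : V, ∃ e, ρ e = u ∧ γ e = v := by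
    intro u v
    obtain ⟨e, he⟩ := Finset.card_eq_one.1 (g1 v u)
    have : e ∈ Finset.univ.filter (fun e => γ e = v ∧ ρ e = u) := by rw [he]; simp
    simp only [Finset.mem_filter, Finset.mem_univ, true_and] at this
    exact ⟨e, this.2, this.1⟩
  choose cell hcρ hcγ using huniq
  let f : V ≃ Fin (∑ i, h i) := finSigmaFinEquiv
  have hrow : ∀ u, Function.Injective fun v => σ (cell u v) := by
    intro u v v' hv
    obtain ⟨e', he⟩ := Finset.card_eq_one.1 (s1 (σ (cell u v)) u)
    have h1 : cell u v ∈ Finset.univ.filter (fun x => σ x = σ (cell u v) ∧ ρ x = u) := by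
      simp [hcρ]
    have h2 : cell u v' ∈ Finset.univ.filter (fun x => σ x = σ (cell u v) ∧ ρ x = u) := by
      simp only [Finset.mem_filter, Finset.mem_univ, true_and]
      exact ⟨hv.symm, hcρ _ _⟩
    rw [he, Finset.mem_singleton] at h1 h2
    rw [← hcγ u v, ← hcγ u v', h1, h2]
  have hcol : ∀ v, Function.Injective fun u => σ (cell u v) := by
    intro v u u' hv
    obtain ⟨e', he⟩ := Finset.card_eq_one.1 (s2 (σ (cell u v)) v)
    have h1 : cell u v ∈ Finset.univ.filter (fun x => σ x = σ (cell u v) ∧ γ x = v) := by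
      simp [hcγ]
    have h2 : cell u' v ∈ Finset.univ.filter (fun x => σ x = σ (cell u v) ∧ γ x = v) := by
      simp only [Finset.mem_filter, Finset.mem_univ, true_and]
      exact ⟨hv.symm, hcγ _ _⟩
    rw [he, Finset.mem_singleton] at h1 h2
    rw [← hcρ u v, ← hcρ u' v, h1, h2]
  let R : Fin k → Finset (Fin (∑ i, h i)) := fun i =>
    Finset.univ.filter fun n => (f.symm n).1 = i
  have hRcard : ∀ i, (R i).card = h i := by
    intro i
    have : R i = (Finset.univ.filter fun v : V => v.1 = i).map f.toEmbedding := by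
      ext n
      simp only [R, Finset.mem_filter, Finset.mem_univ, true_and, Finset.mem_map,
        Equiv.coe_toEmbedding]
      constructor
      · intro hn; exact ⟨f.symm n, hn, by simp⟩
      · rintro ⟨v, hv, rfl⟩; simpa using hv
    rw [this, Finset.card_map, ← Fintype.card_subtype,
      Fintype.card_congr (Equiv.sigmaSubtype i), Fintype.card_fin]
  have hRdisj : ∀ i j, i ≠ j → Disjoint (R i) (R j) := by
    intro i j hij
    rw [Finset.disjoint_left]
    intro n hn hn'
    simp only [R, Finset.mem_filter, Finset.mem_univ, true_and] at hn hn'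
    exact hij (hn.symm.trans hn')
  refine ⟨fun n n' => f (σ (cell (f.symm n) (f.symm n'))), ⟨?_, ?_⟩, R, R, R, hRcard, hRcard,
    hRcard, hRdisj, hRdisj, hRdisj, ?_⟩
  · intro n
    refine Finite.injective_iff_bijective.1 ?_
    exact f.injective.comp ((hrow _).comp f.symm.injective)
  · intro n
    refine Finite.injective_iff_bijective.1 ?_
    exact f.injective.comp ((hcol (f.symm n)).comp f.symm.injective)
  · intro i n hn n' hn'
    simp only [R, Finset.mem_filter, Finset.mem_univ, true_and, Equiv.symm_apply_apply] at hn hn' ⊢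
    set e := cell (f.symm n) (f.symm n') with he
    have h1 : e.1.1 = i := by rw [← hρ, hcρ, hn]
    have h2 : e.1.2.1 = i := by rw [← hγ, hcγ, hn']
    rw [hσ]
    by_contra hne
    have h3 := hx4 i _ hne
    have h4 : x e.1.1 e.1.2.1 e.1.2.2 = 0 := by rw [h1, h2]; exact h3
    have := e.2.2
    omega

/-! ### Grouping colours evenly -/

/-- A finite family of weights bounded by `r` is split into groups of prescribed, nearly equal
sizes in such a way that any two group sums differ by at most `r`. -/
theorem exists_even_grouping {C G : Type*} [Fintype C] [Fintype G] [DecidableEq C] [DecidableEq G]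
    (n : G → ℕ) (hn : ∑ g, n g = Fintype.card C) (hn' : ∀ g g', n g ≤ n g' + 1) (κ : C → ℕ)
    (r : ℕ) (hκ : ∀ c, κ c ≤ r) :
    ∃ τ : C → G, (∀ g, (Finset.univ.filter fun c => τ c = g).card = n g) ∧
      ∀ g g', ∑ c with τ c = g, κ c ≤ ∑ c with τ c = g', κ c + r := by
  let T : Finset (C → G) := Finset.univ.filter fun τ =>
    ∀ g, (Finset.univ.filter fun c => τ c = g).card = n g
  have hT : T.Nonempty := by
    have e : C ≃ Σ g, Fin (n g) := Fintype.equivOfCardEq (by simp [hn])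
    refine ⟨fun c => (e c).1, ?_⟩
    simp only [T, Finset.mem_filter, Finset.mem_univ, true_and]
    intro g
    rw [← Fintype.card_subtype, Fintype.card_congr (e.subtypeEquiv (q := fun s => s.1 = g)
      (fun c => Iff.rfl)), Fintype.card_congr (Equiv.sigmaSubtype g), Fintype.card_fin]
  obtain ⟨τ, hτ, hmin⟩ := Finset.exists_min_image T
    (fun τ => ∑ g, (∑ c with τ c = g, κ c) ^ 2) hT
  simp only [T, Finset.mem_filter, Finset.mem_univ, true_and] at hτ hmin
  refine ⟨τ, hτ, ?_⟩
  intro g g'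
  by_contra! hlt
  have hgg : g ≠ g' := by rintro rfl; omega
  -- some weight in the heavy group exceeds some weight in the light one
  have hex : ∃ c c', τ c = g ∧ τ c' = g' ∧ κ c' < κ c := by
    by_contra! hcon
    let t := (Finset.univ.filter fun c => τ c = g).sup κ
    have h1 : ∑ c with τ c = g, κ c ≤ n g * t := by
      rw [← hτ g, ← smul_eq_mul]
      exact Finset.sum_le_card_nsmul _ _ _ fun c hc => Finset.le_sup hc
    have h2 : n g' * t ≤ ∑ c with τ c = g', κ c := by
      rw [← hτ g', ← smul_eq_mul]
      refine Finset.card_nsmul_le_sum _ _ _ fun c hc => Finset.sup_le fun d hd => ?_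
      simp only [Finset.mem_filter, Finset.mem_univ, true_and] at hc hd
      exact hcon d c hd hc
    have h3 : t ≤ r := Finset.sup_le fun c _ => hκ c
    have h4 := Nat.mul_le_mul_right t (hn' g g')
    rw [add_mul, one_mul] at h4
    omega
  obtain ⟨c, c', hc, hc', hcc⟩ := hex
  let s : C ≃ C := Equiv.swap c c'
  have hsum : ∀ (φ : C → ℕ) (a : G), ∑ d with τ (s d) = a, φ d = ∑ d with τ d = a, φ (s d) := by
    intro φ a
    rw [Finset.sum_filter, Finset.sum_filter, ← s.sum_comp]
    simp [s]
  have h := hmin (τ ∘ s) (by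
    intro a
    have := hsum (fun _ => 1) a
    simpa only [Finset.sum_const, smul_eq_mul, mul_one, Function.comp, hτ] using this)
  simp only [Function.comp, hsum] at h
  have hother : ∀ a, a ≠ g → a ≠ g' → ∑ d with τ d = a, κ (s d) = ∑ d with τ d = a, κ d := by
    intro a ha ha'
    refine Finset.sum_congr rfl fun d hd => ?_
    simp only [Finset.mem_filter, Finset.mem_univ, true_and] at hd
    rw [Equiv.swap_apply_of_ne_of_ne]
    · rintro rfl; exact ha (hd.symm.trans hc)
    · rintro rfl; exact ha' (hd.symm.trans hc')
  have hg1 : ∑ d with τ d = g, κ (s d) + κ c = ∑ d with τ d = g, κ d + κ c' := by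
    rw [← Finset.add_sum_erase _ _ (show c ∈ Finset.univ.filter fun d => τ d = g by simp [hc]),
      ← Finset.add_sum_erase _ κ (show c ∈ Finset.univ.filter fun d => τ d = g by simp [hc])]
    have : ∑ d ∈ (Finset.univ.filter fun d => τ d = g).erase c, κ (s d) =
        ∑ d ∈ (Finset.univ.filter fun d => τ d = g).erase c, κ d := by
      refine Finset.sum_congr rfl fun d hd => ?_
      simp only [Finset.mem_erase, Finset.mem_filter, Finset.mem_univ, true_and] at hd
      rw [Equiv.swap_apply_of_ne_of_ne hd.1]
      rintro rfl; exact hgg (hd.2.symm.trans hc')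
    rw [this]
    simp only [s, Equiv.swap_apply_left]
    omega
  have hg2 : ∑ d with τ d = g', κ (s d) + κ c' = ∑ d with τ d = g', κ d + κ c := by
    rw [← Finset.add_sum_erase _ _ (show c' ∈ Finset.univ.filter fun d => τ d = g' by simp [hc']),
      ← Finset.add_sum_erase _ κ (show c' ∈ Finset.univ.filter fun d => τ d = g' by simp [hc'])]
    have : ∑ d ∈ (Finset.univ.filter fun d => τ d = g').erase c', κ (s d) =
        ∑ d ∈ (Finset.univ.filter fun d => τ d = g').erase c', κ d := by
      refine Finset.sum_congr rfl fun d hd => ?_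
      simp only [Finset.mem_erase, Finset.mem_filter, Finset.mem_univ, true_and] at hd
      rw [Equiv.swap_apply_of_ne_of_ne _ hd.1]
      rintro rfl; exact hgg (hc.symm.trans hd.2)
    rw [this]
    simp only [s, Equiv.swap_apply_right]
    omega
  have hsplit : ∀ F : G → ℕ, ∑ a, F a = F g + (F g' + ∑ a ∈ (Finset.univ.erase g).erase g', F a) := by
    intro F
    rw [← Finset.add_sum_erase _ _ (Finset.mem_univ g),
      ← Finset.add_sum_erase _ _ (show g' ∈ Finset.univ.erase g by simp [hgg.symm])]
  rw [hsplit, hsplit] at h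
  have hrest : ∑ a ∈ (Finset.univ.erase g).erase g', (∑ d with τ d = a, κ (s d)) ^ 2 =
      ∑ a ∈ (Finset.univ.erase g).erase g', (∑ d with τ d = a, κ d) ^ 2 := by
    refine Finset.sum_congr rfl fun a ha => ?_
    simp only [Finset.mem_erase, Finset.mem_univ, and_true] at ha
    rw [hother a ha.2 ha.1]
  rw [hrest] at h
  have hκc := hκ c
  generalize ∑ d with τ d = g, κ (s d) = A at *
  generalize ∑ d with τ d = g', κ (s d) = A' at *
  generalize ∑ d with τ d = g, κ d = Z at *
  generalize ∑ d with τ d = g', κ d = Z' at *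
  obtain ⟨δ, hδ⟩ : ∃ δ, κ c = κ c' + δ := ⟨κ c - κ c', by omega⟩
  have e1 : Z = A + δ := by omega
  have e2 : A' = Z' + δ := by omega
  subst e1 e2
  nlinarith

/-! ### Completing a packing of the small parts by three equal large parts -/

/-- Combinatorial core: a decomposition of the missing pairs into `3 * H` colour classes, each
colour being assigned to a permutation of the three large parts. -/
theorem hasOutline_of_colour_classes {J C : Type*} [Fintype J] [DecidableEq J] [Fintype C]
    (H : ℕ) (b : J → ℕ) (y : J → J → J → ℕ) (RC RS CS : C → J → J → ℕ) (xR xC xS : C → J → ℕ)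
    (hRC : ∀ i j, ∑ c, RC c i j + ∑ l, y i j l = if i = j then 0 else b i * b j)
    (hRS : ∀ i l, ∑ c, RS c i l + ∑ j, y i j l = if i = l then 0 else b i * b l)
    (hCS : ∀ j l, ∑ c, CS c j l + ∑ i, y i j l = if j = l then 0 else b j * b l)
    (hR : ∀ c i, ∑ j, RC c i j + xR c i = b i) (hR' : ∀ c i, ∑ l, RS c i l + xR c i = b i)
    (hC : ∀ c j, ∑ i, RC c i j + xC c j = b j) (hC' : ∀ c j, ∑ l, CS c j l + xC c j = b j)
    (hS : ∀ c l, ∑ i, RS c i l + xS c l = b l) (hS' : ∀ c l, ∑ j, CS c j l + xS c l = b l)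
    (ro cl sy : C → Fin 3) (hrc : ∀ c, ro c ≠ cl c) (hrs : ∀ c, ro c ≠ sy c)
    (hcs : ∀ c, cl c ≠ sy c)
    (hrw : ∀ T, (Finset.univ.filter fun c => ro c = T).card = H)
    (hcl : ∀ T, (Finset.univ.filter fun c => cl c = T).card = H)
    (hsy : ∀ T, (Finset.univ.filter fun c => sy c = T).card = H)
    (hsum : ∀ T U W, ∑ c, (if ro c = T ∧ cl c = U ∧ sy c = W then ∑ l, xS c l else 0) ≤ H * H) :
    HasOutline (Sum.elim (fun _ : Fin 3 => H) b) := by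
  have hRS_eq : ∀ c, ∑ i, xR c i = ∑ l, xS c l := by
    intro c
    have h1 : ∑ i, (∑ l, RS c i l + xR c i) = ∑ i, b i := by simp only [hR']
    have h2 : ∑ l, (∑ i, RS c i l + xS c l) = ∑ i, b i := by simp only [hS]
    rw [Finset.sum_add_distrib] at h1 h2
    rw [Finset.sum_comm] at h1
    omega
  have hCS_eq : ∀ c, ∑ i, xC c i = ∑ l, xS c l := by
    intro c
    have h1 : ∑ i, (∑ l, CS c i l + xC c i) = ∑ i, b i := by simp only [hC']
    have h2 : ∑ l, (∑ i, CS c i l + xS c l) = ∑ i, b i := by simp only [hS']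
    rw [Finset.sum_add_distrib] at h1 h2
    rw [Finset.sum_comm] at h1
    omega
  -- the pattern of three large parts is that of an idempotent latin square of order three
  let A : Fin 3 → Fin 3 → Fin 3 → ℕ := fun T U W =>
    if (T = U ∧ U = W) ∨ (T ≠ U ∧ U ≠ W ∧ T ≠ W) then H * H else 0
  let K : Fin 3 → Fin 3 → Fin 3 → ℕ := fun T U W =>
    ∑ c, if ro c = T ∧ cl c = U ∧ sy c = W then ∑ l, xS c l else 0
  have hKA : ∀ T U W, K T U W ≤ A T U W := by
    intro T U W
    by_cases h : T ≠ U ∧ U ≠ W ∧ T ≠ W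
    · simp only [A, h, not_false_eq_true, and_self, or_true, if_true, ne_eq]
      exact hsum T U W
    · have : K T U W = 0 := by
        refine Finset.sum_eq_zero fun c _ => if_neg ?_
        rintro ⟨rfl, rfl, rfl⟩
        exact h ⟨hrc c, hcs c, hrs c⟩
      omega
  have hA1 : ∀ T U, ∑ W, A T U W = H * H := by
    intro T U
    fin_cases T <;> fin_cases U <;> simp [A, Fin.sum_univ_three]
  have hA2 : ∀ T W, ∑ U, A T U W = H * H := by
    intro T U
    fin_cases T <;> fin_cases U <;> simp [A, Fin.sum_univ_three]
  have hA3 : ∀ U W, ∑ T, A T U W = H * H := by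
    intro T U
    fin_cases T <;> fin_cases U <;> simp [A, Fin.sum_univ_three]
  have hzK : ∀ T U W, A T U W - K T U W + K T U W = A T U W := fun T U W =>
    Nat.sub_add_cancel (hKA T U W)
  have sum_fst : ∀ (p : C → Prop) [DecidablePred p] (f : C → Fin 3) (g : C → ℕ),
      ∑ T, ∑ c, (if f c = T ∧ p c then g c else 0) = ∑ c, if p c then g c else 0 := by
    intro p _ f g
    rw [Finset.sum_comm]
    refine Finset.sum_congr rfl fun c _ => ?_
    by_cases hp : p c <;> simp [hp]
  have sum_snd : ∀ (p : C → Prop) [DecidablePred p] (f : C → Fin 3) (g : C → ℕ),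
      ∑ T, ∑ c, (if p c ∧ f c = T then g c else 0) = ∑ c, if p c then g c else 0 := by
    intro p _ f g
    rw [Finset.sum_comm]
    refine Finset.sum_congr rfl fun c _ => ?_
    by_cases hp : p c <;> simp [hp]
  have sum_one : ∀ (f : C → Fin 3) (g : C → ℕ),
      ∑ T, ∑ c, (if f c = T then g c else 0) = ∑ c, g c := by
    intro f g
    rw [Finset.sum_comm]
    refine Finset.sum_congr rfl fun c _ => ?_
    simp
  have sum_in : ∀ (p : C → Prop) [DecidablePred p] (g : C → J → ℕ),
      ∑ l, ∑ c, (if p c then g c l else 0) = ∑ c, if p c then ∑ l, g c l else 0 := by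
    intro p _ g
    rw [Finset.sum_comm]
    refine Finset.sum_congr rfl fun c _ => ?_
    by_cases hp : p c <;> simp [hp]
  have sum_b : ∀ (f : C → Fin 3) (T : Fin 3) (g g' : C → ℕ) (B : ℕ),
      (Finset.univ.filter fun c => f c = T).card = H → (∀ c, g c + g' c = B) →
      ∑ c, (if f c = T then g' c else 0) + ∑ c, (if f c = T then g c else 0) = H * B := by
    intro f T g g' B hf hg
    rw [← Finset.sum_add_distrib, ← hf, Finset.card_filter, Finset.sum_mul]
    refine Finset.sum_congr rfl fun c _ => ?_
    rw [← hg c]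
    split_ifs <;> omega
  have hK1 : ∀ T U, ∑ W, K T U W = ∑ c, if ro c = T ∧ cl c = U then ∑ l, xS c l else 0 := by
    intro T U
    have := sum_snd (fun c => ro c = T ∧ cl c = U) sy (fun c => ∑ l, xS c l)
    simpa only [K, and_assoc] using this
  have hK2 : ∀ T W, ∑ U, K T U W = ∑ c, if ro c = T ∧ sy c = W then ∑ l, xS c l else 0 := by
    intro T W
    rw [← sum_fst (fun c => ro c = T ∧ sy c = W) cl (fun c => ∑ l, xS c l)]
    simp only [K, and_left_comm]
  have hK3 : ∀ U W, ∑ T, K T U W = ∑ c, if cl c = U ∧ sy c = W then ∑ l, xS c l else 0 := by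
    intro U W
    exact sum_fst (fun c => cl c = U ∧ sy c = W) ro (fun c => ∑ l, xS c l)
  let x : Fin 3 ⊕ J → Fin 3 ⊕ J → Fin 3 ⊕ J → ℕ := fun p q s =>
    match p, q, s with
    | .inr i, .inr j, .inr l => y i j l + if i = j ∧ j = l then b i * b i else 0
    | .inr i, .inr j, .inl T => ∑ c, if sy c = T then RC c i j else 0
    | .inr i, .inl T, .inr l => ∑ c, if cl c = T then RS c i l else 0
    | .inl T, .inr j, .inr l => ∑ c, if ro c = T then CS c j l else 0
    | .inr i, .inl T, .inl U => ∑ c, if cl c = T ∧ sy c = U then xR c i else 0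
    | .inl T, .inr j, .inl U => ∑ c, if ro c = T ∧ sy c = U then xC c j else 0
    | .inl T, .inl U, .inr l => ∑ c, if ro c = T ∧ cl c = U then xS c l else 0
    | .inl T, .inl U, .inl W => A T U W - K T U W
  have hhole1 : ∀ i j, ∑ l, (if i = j ∧ j = l then b i * b i else 0) =
      if i = j then b i * b i else 0 := by
    intro i j
    by_cases h : i = j <;> simp [h]
  have hhole2 : ∀ i l, ∑ j, (if i = j ∧ j = l then b i * b i else 0) =
      if i = l then b i * b i else 0 := by
    intro i l
    by_cases h : i = l
    · subst h
      rw [Finset.sum_eq_single i]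
      · simp
      · intro j _ hj
        simp [hj]
      · simp
    · rw [if_neg h]
      refine Finset.sum_eq_zero fun j _ => if_neg ?_
      rintro ⟨rfl, rfl⟩
      exact h rfl
  have hhole3 : ∀ j l, ∑ i, (if i = j ∧ j = l then b i * b i else 0) =
      if j = l then b j * b j else 0 := by
    intro i j
    by_cases h : i = j <;> simp [h]
  have hbb : ∀ i j, (if i = j then 0 else b i * b j) + (if i = j then b i * b i else 0) =
      b i * b j := by
    intro i j
    by_cases h : i = j <;> simp [h]
  have hxR : ∀ i j, i = j → (∀ c, RC c i j = 0) ∧ ∀ l, y i j l = 0 := by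
    intro i j hij
    have h1 := hRC i j
    rw [if_pos hij] at h1
    have h2 : ∑ c, RC c i j = 0 := by omega
    have h3 : ∑ l, y i j l = 0 := by omega
    rw [Finset.sum_eq_zero_iff] at h2 h3
    exact ⟨fun c => h2 c (Finset.mem_univ c), fun l => h3 l (Finset.mem_univ l)⟩
  refine ⟨x, ?_, ?_, ?_, ?_⟩
  · rintro (T | i) (U | j) <;> rw [Fintype.sum_sum_type] <;> simp only [x, Sum.elim_inl, Sum.elim_inr]
    · rw [sum_in, ← hK1, ← Finset.sum_add_distrib]
      simp only [hzK, hA1]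
    · rw [sum_snd, sum_in]
      exact sum_b ro T _ _ (b j) (hrw T) fun c => hC' c j
    · rw [sum_snd, sum_in, mul_comm]
      exact sum_b cl U _ _ (b i) (hcl U) fun c => hR' c i
    · rw [sum_one, Finset.sum_add_distrib, hhole1, ← add_assoc, hRC, hbb]
  · rintro (T | i) (U | j) <;> rw [Fintype.sum_sum_type] <;> simp only [x, Sum.elim_inl, Sum.elim_inr]
    · rw [sum_in]
      simp only [hCS_eq]
      rw [← hK2, ← Finset.sum_add_distrib]
      simp only [hzK, hA2]
    · rw [sum_snd, sum_in]
      exact sum_b ro T _ _ (b j) (hrw T) fun c => hS' c j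
    · rw [sum_fst, sum_in, mul_comm]
      exact sum_b sy U _ _ (b i) (hsy U) fun c => hR c i
    · rw [sum_one, Finset.sum_add_distrib, hhole2, ← add_assoc, hRS, hbb]
  · rintro (T | i) (U | j) <;> rw [Fintype.sum_sum_type] <;> simp only [x, Sum.elim_inl, Sum.elim_inr]
    · rw [sum_in]
      simp only [hRS_eq]
      rw [← hK3, ← Finset.sum_add_distrib]
      simp only [hzK, hA3]
    · rw [sum_fst, sum_in]
      exact sum_b cl T _ _ (b j) (hcl T) fun c => hS c j
    · rw [sum_fst, sum_in, mul_comm]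
      exact sum_b sy U _ _ (b i) (hsy U) fun c => hC c i
    · rw [sum_one, Finset.sum_add_distrib, hhole3, ← add_assoc, hCS, hbb]
  · rintro (T | i) (W | l) hne
    · have hTW : T ≠ W := fun h => hne (by rw [h])
      simp [x, A, hTW]
    · simp only [x]
      refine Finset.sum_eq_zero fun c _ => if_neg ?_
      rintro ⟨h1, h2⟩
      exact hrc c (h1.trans h2.symm)
    · simp only [x]
      simp [(hxR i i rfl).1]
    · have hil : i ≠ l := fun h => hne (by rw [h])
      simp [x, (hxR i i rfl).2, hil]

/-- The missing pairs of a packing are decomposed into colour classes along a hexagon whose sides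
are the three kinds of pairs. -/
theorem exists_hexagon_decomposition {J : Type*} [Fintype J] [DecidableEq J] (N : ℕ) (b : J → ℕ)
    (RC RS CS : J → J → ℕ) (xR xC xS : J → ℕ)
    (hR : ∀ i, ∑ j, RC i j + xR i = N * b i) (hR' : ∀ i, ∑ l, RS i l + xR i = N * b i)
    (hC : ∀ j, ∑ i, RC i j + xC j = N * b j) (hC' : ∀ j, ∑ l, CS j l + xC j = N * b j)
    (hS : ∀ l, ∑ i, RS i l + xS l = N * b l) (hS' : ∀ l, ∑ j, CS j l + xS l = N * b l) :
    ∃ (RC' RS' CS' : Fin N → J → J → ℕ) (xR' xC' xS' : Fin N → J → ℕ),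
      (∀ i j, ∑ c, RC' c i j = RC i j) ∧ (∀ i l, ∑ c, RS' c i l = RS i l) ∧
      (∀ j l, ∑ c, CS' c j l = CS j l) ∧ (∀ l, ∑ c, xS' c l = xS l) ∧
      (∀ c i, ∑ j, RC' c i j + xR' c i = b i) ∧ (∀ c i, ∑ l, RS' c i l + xR' c i = b i) ∧
      (∀ c j, ∑ i, RC' c i j + xC' c j = b j) ∧ (∀ c j, ∑ l, CS' c j l + xC' c j = b j) ∧
      (∀ c l, ∑ i, RS' c i l + xS' c l = b l) ∧ (∀ c l, ∑ j, CS' c j l + xS' c l = b l) ∧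
      (∀ c l, xS l / N ≤ xS' c l ∧ xS' c l ≤ xS l / N + if N ∣ xS l then 0 else 1) := by
  let f : J ⊕ J ⊕ J → J ⊕ J ⊕ J → ℕ := fun p q =>
    match p, q with
    | .inl i, .inl j => RC i j
    | .inl _, .inr (.inl _) => 0
    | .inl i, .inr (.inr j) => if i = j then xR i else 0
    | .inr (.inl i), .inl j => if i = j then xC i else 0
    | .inr (.inl j), .inr (.inl l) => CS j l
    | .inr (.inl _), .inr (.inr _) => 0
    | .inr (.inr _), .inl _ => 0
    | .inr (.inr i), .inr (.inl j) => if i = j then xS i else 0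
    | .inr (.inr l), .inr (.inr i) => RS i l
  let mark : J ⊕ J ⊕ J → J ⊕ J ⊕ J := fun p =>
    match p with
    | .inl i => .inr (.inr i)
    | .inr (.inl i) => .inl i
    | .inr (.inr i) => .inr (.inl i)
  let w : J ⊕ J ⊕ J → ℕ := Sum.elim b (Sum.elim b b)
  obtain ⟨g, hg1, hg2, hg3, hg4⟩ := exists_balanced_decomposition N f w w mark
    (by
      rintro (i | i | i) <;> simp only [Fintype.sum_sum_type, f, w, Sum.elim_inl, Sum.elim_inr] <;>
        simp only [Finset.sum_const_zero, Finset.sum_ite_eq, Finset.mem_univ, if_true]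
      · have := hR i; omega
      · have := hC' i; omega
      · have := hS i; omega)
    (by
      rintro (i | i | i) <;> simp only [Fintype.sum_sum_type, f, w, Sum.elim_inl, Sum.elim_inr] <;>
        simp only [Finset.sum_const_zero, Finset.sum_ite_eq', Finset.mem_univ, if_true]
      · have := hC i; omega
      · have := hS' i; omega
      · have := hR' i; omega)
  have hzero : ∀ c p q, f p q = 0 → g c p q = 0 := by
    intro c p q h
    rw [← hg1, Finset.sum_eq_zero_iff] at h
    exact h c (Finset.mem_univ c)
  have z1 : ∀ c i j, g c (.inl i) (.inr (.inl j)) = 0 := fun c i j => hzero _ _ _ rfl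
  have z2 : ∀ c i j, g c (.inr (.inl i)) (.inr (.inr j)) = 0 := fun c i j => hzero _ _ _ rfl
  have z3 : ∀ c i j, g c (.inr (.inr i)) (.inl j) = 0 := fun c i j => hzero _ _ _ rfl
  have d1 : ∀ c i j, i ≠ j → g c (.inl i) (.inr (.inr j)) = 0 := fun c i j h =>
    hzero _ _ _ (if_neg h)
  have d2 : ∀ c i j, i ≠ j → g c (.inr (.inl i)) (.inl j) = 0 := fun c i j h =>
    hzero _ _ _ (if_neg h)
  have d3 : ∀ c i j, i ≠ j → g c (.inr (.inr i)) (.inr (.inl j)) = 0 := fun c i j h =>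
    hzero _ _ _ (if_neg h)
  have row : ∀ (F : J → J → ℕ) (i : J), (∀ i j, i ≠ j → F i j = 0) → ∑ j, F i j = F i i := by
    intro F i hF
    exact Finset.sum_eq_single i (fun j _ hj => hF i j hj.symm) (by simp)
  have col : ∀ (F : J → J → ℕ) (j : J), (∀ i j, i ≠ j → F i j = 0) → ∑ i, F i j = F j j := by
    intro F j hF
    exact Finset.sum_eq_single j (fun i _ hi => hF i j hi) (by simp)
  refine ⟨fun c i j => g c (.inl i) (.inl j), fun c i l => g c (.inr (.inr l)) (.inr (.inr i)),
    fun c j l => g c (.inr (.inl j)) (.inr (.inl l)), fun c i => g c (.inl i) (.inr (.inr i)),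
    fun c j => g c (.inr (.inl j)) (.inl j), fun c l => g c (.inr (.inr l)) (.inr (.inl l)),
    fun i j => hg1 _ _, fun i l => hg1 _ _, fun j l => hg1 _ _, ?_, ?_, ?_, ?_, ?_, ?_, ?_, ?_⟩
  · intro l
    rw [hg1]
    exact if_pos rfl
  · intro c i
    have h := hg2 c (.inl i)
    simp only [Fintype.sum_sum_type, z1, Finset.sum_const_zero] at h
    rw [row _ i (d1 c)] at h
    simpa [w] using h
  · intro c i
    have h := hg3 c (.inr (.inr i))
    simp only [Fintype.sum_sum_type, z2, Finset.sum_const_zero] at h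
    rw [col _ i (d1 c)] at h
    simp only [w, Sum.elim_inr] at h ⊢
    omega
  · intro c i
    have h := hg3 c (.inl i)
    simp only [Fintype.sum_sum_type, z3, Finset.sum_const_zero] at h
    rw [col _ i (d2 c)] at h
    simpa [w] using h
  · intro c i
    have h := hg2 c (.inr (.inl i))
    simp only [Fintype.sum_sum_type, z2, Finset.sum_const_zero] at h
    rw [row _ i (d2 c)] at h
    simp only [w, Sum.elim_inr, Sum.elim_inl] at h ⊢
    omega
  · intro c i
    have h := hg2 c (.inr (.inr i))
    simp only [Fintype.sum_sum_type, z3, Finset.sum_const_zero] at h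
    rw [row _ i (d3 c)] at h
    simp only [w, Sum.elim_inr] at h ⊢
    omega
  · intro c i
    have h := hg3 c (.inr (.inl i))
    simp only [Fintype.sum_sum_type, z1, Finset.sum_const_zero] at h
    rw [col _ i (d3 c)] at h
    simp only [w, Sum.elim_inr, Sum.elim_inl] at h ⊢
    omega
  · intro c l
    have h := hg4 c (.inr (.inr l))
    simpa [f, mark] using h

/-- A packing of the small parts whose deficiency is small enough is completed by three large
parts of size `H`. -/
theorem hasOutline_of_packing {J : Type*} [Fintype J] [DecidableEq J] (H : ℕ) (b : J → ℕ)
    (y : J → J → J → ℕ) (RC RS CS : J → J → ℕ) (xR xC xS : J → ℕ)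
    (hRC : ∀ i j, RC i j + ∑ l, y i j l = if i = j then 0 else b i * b j)
    (hRS : ∀ i l, RS i l + ∑ j, y i j l = if i = l then 0 else b i * b l)
    (hCS : ∀ j l, CS j l + ∑ i, y i j l = if j = l then 0 else b j * b l)
    (hR : ∀ i, ∑ j, RC i j + xR i = 3 * H * b i) (hR' : ∀ i, ∑ l, RS i l + xR i = 3 * H * b i)
    (hC : ∀ j, ∑ i, RC i j + xC j = 3 * H * b j) (hC' : ∀ j, ∑ l, CS j l + xC j = 3 * H * b j)
    (hS : ∀ l, ∑ i, RS i l + xS l = 3 * H * b l) (hS' : ∀ l, ∑ j, CS j l + xS l = 3 * H * b l)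
    (hnum : ∑ l, xS l + 5 * ∑ l, (if 3 * H ∣ xS l then 0 else 1) +
        3 * (H % 2) * ∑ l, xS l / (3 * H) ≤ 6 * (H * H) + 5 ∨
      (H + 1) / 2 * (∑ l, xS l / (3 * H) + ∑ l, (if 3 * H ∣ xS l then 0 else 1)) ≤ H * H) :
    HasOutline (Sum.elim (fun _ : Fin 3 => H) b) := by
  obtain ⟨RC', RS', CS', xR', xC', xS', e1, e2, e3, e4, f1, f2, f3, f4, f5, f6, hbd⟩ :=
    exists_hexagon_decomposition (3 * H) b RC RS CS xR xC xS hR hR' hC hC' hS hS'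
  set m := ∑ l, xS l / (3 * H) with hm
  set r := ∑ l, (if 3 * H ∣ xS l then 0 else 1) with hr
  let κ : Fin (3 * H) → ℕ := fun c => ∑ l, xS' c l
  have hκ1 : ∀ c, m ≤ κ c := fun c => Finset.sum_le_sum fun l _ => (hbd c l).1
  have hκ2 : ∀ c, κ c ≤ m + r := by
    intro c
    rw [hm, hr, ← Finset.sum_add_distrib]
    exact Finset.sum_le_sum fun l _ => (hbd c l).2
  have hD : ∑ c, κ c = ∑ l, xS l := by
    rw [Finset.sum_comm]
    simp only [e4]
  let n : Fin 3 × Fin 2 → ℕ := fun g => if g.2 = 0 then H / 2 else H - H / 2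
  obtain ⟨τ, hτ, hdiff⟩ := exists_even_grouping n
    (by simp [n, Fintype.sum_prod_type, Fin.sum_univ_two]; omega)
    (by intro g g'; simp only [n]; split_ifs <;> omega) (fun c => κ c - m) r
    (by intro c; have := hκ2 c; omega)
  have hgroup : ∀ g, ∑ c with τ c = g, κ c = ∑ c with τ c = g, (κ c - m) + n g * m := by
    intro g
    have : n g * m = ∑ c with τ c = g, m := by rw [Finset.sum_const, hτ, smul_eq_mul]
    rw [this, ← Finset.sum_add_distrib]
    refine Finset.sum_congr rfl fun c _ => ?_
    have := hκ1 c
    omega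
  have htotal : ∑ g, ∑ c with τ c = g, (κ c - m) + 3 * H * m = ∑ l, xS l := by
    rw [Finset.sum_fiberwise, ← hD]
    have : 3 * H * m = ∑ c : Fin (3 * H), m := by simp
    rw [this, ← Finset.sum_add_distrib]
    refine Finset.sum_congr rfl fun c _ => ?_
    have := hκ1 c
    omega
  have hn : ∀ g, n g ≤ (H + 1) / 2 := by
    intro g
    simp only [n]
    split_ifs <;> omega
  have hle : ∀ g, ∑ c with τ c = g, κ c ≤ H * H := by
    intro g
    rcases hnum with hnum | hnum
    · have h6 : 6 * ∑ c with τ c = g, (κ c - m) ≤ ∑ g', ∑ c with τ c = g', (κ c - m) + 5 * r := by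
        rw [← Finset.add_sum_erase _ _ (Finset.mem_univ g)]
        have : ∑ g' ∈ Finset.univ.erase g, ∑ c with τ c = g, (κ c - m) ≤
            ∑ g' ∈ Finset.univ.erase g, (∑ c with τ c = g', (κ c - m) + r) :=
          Finset.sum_le_sum fun g' _ => hdiff g g'
        rw [Finset.sum_add_distrib] at this
        simp only [Finset.sum_const, Finset.card_erase_of_mem (Finset.mem_univ g),
          Finset.card_univ, Fintype.card_prod, Fintype.card_fin, smul_eq_mul] at this
        omega
      have h7 : 6 * (n g * m) ≤ 3 * H * m + 3 * (H % 2) * m := by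
        rw [← mul_assoc, ← add_mul]
        refine Nat.mul_le_mul_right m ?_
        have := hn g
        omega
      rw [hgroup]
      omega
    · calc ∑ c with τ c = g, κ c ≤ (Finset.univ.filter fun c => τ c = g).card • (m + r) :=
            Finset.sum_le_card_nsmul _ _ _ fun c _ => hκ2 c
        _ = n g * (m + r) := by rw [hτ, smul_eq_mul]
        _ ≤ (H + 1) / 2 * (m + r) := Nat.mul_le_mul_right _ (hn g)
        _ ≤ H * H := hnum
  have hcount : ∀ (φ : Fin 3 × Fin 2 → Fin 3) (T : Fin 3),
      (Finset.univ.filter fun c => φ (τ c) = T).card = ∑ g, if φ g = T then n g else 0 := by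
    intro φ T
    rw [Finset.card_eq_sum_card_fiberwise (f := τ) (t := Finset.univ) (by simp)]
    refine Finset.sum_congr rfl fun g _ => ?_
    rw [Finset.filter_filter]
    split_ifs with h
    · rw [← hτ g]
      congr 1
      ext c
      simp only [Finset.mem_filter, Finset.mem_univ, true_and]
      exact ⟨fun h' => h'.2, fun h' => ⟨h' ▸ h, h'⟩⟩
    · rw [Finset.card_eq_zero, Finset.filter_eq_empty_iff]
      rintro c - ⟨h1, h2⟩
      exact h (h2 ▸ h1)
  let ro : Fin 3 × Fin 2 → Fin 3 := fun g => g.1 + 2 + if g.2 = 0 then 0 else 2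
  let co : Fin 3 × Fin 2 → Fin 3 := fun g => g.1 + 1 + if g.2 = 0 then 0 else 1
  have hhalf : H / 2 + (H - H / 2) = H := by omega
  have hhalf' : H - H / 2 + H / 2 = H := by omega
  refine hasOutline_of_colour_classes H b y RC' RS' CS' xR' xC' xS' (by simpa only [e1] using hRC)
    (by simpa only [e2] using hRS) (by simpa only [e3] using hCS) f1 f2 f3 f4 f5 f6
    (fun c => ro (τ c)) (fun c => co (τ c)) (fun c => (τ c).1) ?_ ?_ ?_ ?_ ?_ ?_ ?_
  · exact fun c => (by decide : ∀ g : Fin 3 × Fin 2, (g.1 + 2 + if g.2 = 0 then 0 else 2) ≠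
      (g.1 + 1 + if g.2 = 0 then 0 else 1)) (τ c)
  · exact fun c => (by decide : ∀ g : Fin 3 × Fin 2, (g.1 + 2 + if g.2 = 0 then 0 else 2) ≠
      g.1) (τ c)
  · exact fun c => (by decide : ∀ g : Fin 3 × Fin 2, (g.1 + 1 + if g.2 = 0 then 0 else 1) ≠
      g.1) (τ c)
  · intro T
    rw [hcount ro T]
    fin_cases T <;>
      simp [Fintype.sum_prod_type, Fin.sum_univ_three, Fin.sum_univ_two, ro, n, hhalf, hhalf']
  · intro T
    rw [hcount co T]
    fin_cases T <;>
      simp [Fintype.sum_prod_type, Fin.sum_univ_three, Fin.sum_univ_two, co, n, hhalf, hhalf']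
  · intro T
    rw [hcount Prod.fst T]
    fin_cases T <;> simp [Fintype.sum_prod_type, Fin.sum_univ_two, n, hhalf]
  · intro T U W
    refine le_trans ?_ (hle (W, if U = W + 1 then 0 else 1))
    rw [Finset.sum_filter]
    refine Finset.sum_le_sum fun c _ => ?_
    by_cases h : ro (τ c) = T ∧ co (τ c) = U ∧ (τ c).1 = W
    · rw [if_pos h, if_pos]
      obtain ⟨-, rfl, rfl⟩ := h
      exact (by decide : ∀ g : Fin 3 × Fin 2,
        g = (g.1, if (g.1 + 1 + if g.2 = 0 then 0 else 1) = g.1 + 1 then 0 else 1)) (τ c)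
    · rw [if_neg h]
      exact Nat.zero_le _

/-- The condition on the deficiency `x` of a packing under which three parts of size `H`
complete it. -/
def IsSmallDeficiency {J : Type*} [Fintype J] (H : ℕ) (x : J → ℕ) : Prop :=
  ∑ l, x l + 5 * ∑ l, (if 3 * H ∣ x l then 0 else 1) +
      3 * (H % 2) * ∑ l, x l / (3 * H) ≤ 6 * (H * H) + 5 ∨
    (H + 1) / 2 * (∑ l, x l / (3 * H) + ∑ l, (if 3 * H ∣ x l then 0 else 1)) ≤ H * H

theorem IsSmallDeficiency.of_le {J : Type*} [Fintype J] {H : ℕ} (hH : 0 < H) {x : J → ℕ}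
    (h : (H + 1) * ∑ l, x l + 5 * H * ∑ l, (if x l = 0 then 0 else 1) ≤ H * (6 * (H * H) + 5)) :
    IsSmallDeficiency H x := by
  left
  have h1 : ∑ l, (if 3 * H ∣ x l then 0 else 1) ≤ ∑ l, (if x l = 0 then 0 else 1) := by
    refine Finset.sum_le_sum fun l _ => ?_
    by_cases h0 : x l = 0
    · simp [h0]
    · rw [if_neg h0]
      split_ifs <;> omega
  have h2 : 3 * H * ∑ l, x l / (3 * H) ≤ ∑ l, x l := by
    rw [Finset.mul_sum]
    exact Finset.sum_le_sum fun l _ => Nat.mul_div_le _ _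
  refine Nat.le_of_mul_le_mul_left (c := H) (le_trans ?_ h) hH
  have h3 : H % 2 ≤ 1 := by omega
  have h4 : 3 * (H % 2) * ∑ l, x l / (3 * H) ≤ 3 * 1 * ∑ l, x l / (3 * H) := by gcongr
  have h5 := Nat.mul_le_mul_left H h4
  have h6 := Nat.mul_le_mul_left (5 * H) h1
  nlinarith

/-- `hasOutline_of_packing` with the numbers of missing pairs computed from the packing. -/
theorem hasOutline_of_marginals {J : Type*} [Fintype J] [DecidableEq J] (H : ℕ) (b : J → ℕ)
    (y : J → J → J → ℕ) (xR xC xS : J → ℕ)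
    (hy : ∀ i j l, y i j l ≠ 0 → i ≠ j ∧ i ≠ l ∧ j ≠ l)
    (h1 : ∀ i j, ∑ l, y i j l ≤ b i * b j) (h2 : ∀ i l, ∑ j, y i j l ≤ b i * b l)
    (h3 : ∀ j l, ∑ i, y i j l ≤ b j * b l)
    (hR : ∀ i, xR i + b i * ∑ j, b j = ∑ j, ∑ l, y i j l + (3 * H + b i) * b i)
    (hC : ∀ j, xC j + b j * ∑ j, b j = ∑ i, ∑ l, y i j l + (3 * H + b j) * b j)
    (hS : ∀ l, xS l + b l * ∑ j, b j = ∑ i, ∑ j, y i j l + (3 * H + b l) * b l)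
    (hnum : IsSmallDeficiency H xS) :
    HasOutline (Sum.elim (fun _ : Fin 3 => H) b) := by
  have key : ∀ M : J → J → ℕ, (∀ i j, M i j ≤ b i * b j) → (∀ i, M i i = 0) →
      ∀ i j, ((if i = j then 0 else b i * b j) - M i j) + M i j =
        if i = j then 0 else b i * b j := by
    intro M hM hM0 i j
    have := hM i j
    by_cases h : i = j
    · subst h; simp [hM0]
    · simp only [h, if_false]; omega
  have hoff : ∀ i, ∑ j, (if i = j then 0 else b i * b j) + b i * b i = b i * ∑ j, b j := by
    intro i
    rw [Finset.mul_sum, ← Finset.add_sum_erase _ _ (Finset.mem_univ i),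
      ← Finset.add_sum_erase _ (fun j => b i * b j) (Finset.mem_univ i)]
    have : ∑ j ∈ Finset.univ.erase i, (if i = j then 0 else b i * b j) =
        ∑ j ∈ Finset.univ.erase i, b i * b j := by
      refine Finset.sum_congr rfl fun j hj => if_neg ?_
      simp only [Finset.mem_erase] at hj
      exact hj.1.symm
    rw [this]
    simp only [if_true]
    omega
  have hoff' : ∀ j, ∑ i, (if i = j then 0 else b i * b j) + b j * b j = b j * ∑ j, b j := by
    intro j
    rw [← hoff j]
    congr 1
    refine Finset.sum_congr rfl fun i _ => ?_
    simp only [eq_comm, mul_comm]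
  have hrow : ∀ (M : J → J → ℕ), (∀ i j, M i j ≤ b i * b j) → (∀ i, M i i = 0) →
      ∀ i X, X + b i * ∑ j, b j = ∑ j, M i j + (3 * H + b i) * b i →
      ∑ j, ((if i = j then 0 else b i * b j) - M i j) + X = 3 * H * b i := by
    intro M hM hM0 i X hX
    have h : ∑ j, (((if i = j then 0 else b i * b j) - M i j) + M i j) =
        ∑ j, if i = j then 0 else b i * b j := Finset.sum_congr rfl fun j _ => key M hM hM0 i j
    rw [Finset.sum_add_distrib] at h
    have := hoff i
    rw [add_mul] at hX
    omega
  have hcol : ∀ (M : J → J → ℕ), (∀ i j, M i j ≤ b i * b j) → (∀ i, M i i = 0) →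
      ∀ j X, X + b j * ∑ j, b j = ∑ i, M i j + (3 * H + b j) * b j →
      ∑ i, ((if i = j then 0 else b i * b j) - M i j) + X = 3 * H * b j := by
    intro M hM hM0 j X hX
    have h : ∑ i, (((if i = j then 0 else b i * b j) - M i j) + M i j) =
        ∑ i, if i = j then 0 else b i * b j := Finset.sum_congr rfl fun i _ => key M hM hM0 i j
    rw [Finset.sum_add_distrib] at h
    have := hoff' j
    rw [add_mul] at hX
    omega
  have z1 : ∀ i, ∑ l, y i i l = 0 := fun i => Finset.sum_eq_zero fun l _ => by
    by_contra h
    exact (hy _ _ _ h).1 rfl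
  have z2 : ∀ i, ∑ j, y i j i = 0 := fun i => Finset.sum_eq_zero fun l _ => by
    by_contra h
    exact (hy _ _ _ h).2.1 rfl
  have z3 : ∀ j, ∑ i, y i j j = 0 := fun i => Finset.sum_eq_zero fun l _ => by
    by_contra h
    exact (hy _ _ _ h).2.2 rfl
  exact hasOutline_of_packing H b y _ _ _ xR xC xS (key _ h1 z1) (key _ h2 z2) (key _ h3 z3)
    (fun i => hrow _ h1 z1 i _ (hR i))
    (fun i => hrow _ h2 z2 i _ (by rw [Finset.sum_comm]; exact hR i))
    (fun j => hcol _ h1 z1 j _ (hC j))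
    (fun j => hrow _ h3 z3 j _ (by rw [Finset.sum_comm]; exact hC j))
    (fun l => hcol _ h2 z2 l _ (hS l))
    (fun l => hcol _ h3 z3 l _ (by rw [Finset.sum_comm]; exact hS l)) hnum

/-- The packing consisting of a family of triples of points, no two of which agree in two
coordinates, the points being distributed over the small parts by `q`. -/
theorem hasOutline_of_triples {J U E : Type*} [Fintype J] [DecidableEq J] [Fintype U]
    [Fintype E] (H : ℕ) (b : J → ℕ) (q : U → J)
    (hq : ∀ j, (Finset.univ.filter fun u => q u = j).card = b j) (tr tc ts : E → U)
    (hrc : ∀ e, q (tr e) ≠ q (tc e)) (hrs : ∀ e, q (tr e) ≠ q (ts e))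
    (hcs : ∀ e, q (tc e) ≠ q (ts e))
    (irc : Function.Injective fun e => (tr e, tc e))
    (irs : Function.Injective fun e => (tr e, ts e))
    (ics : Function.Injective fun e => (tc e, ts e))
    (xS : J → ℕ)
    (hR : ∀ i, b i * ∑ j, b j ≤
      (Finset.univ.filter fun e => q (tr e) = i).card + (3 * H + b i) * b i)
    (hC : ∀ i, b i * ∑ j, b j ≤
      (Finset.univ.filter fun e => q (tc e) = i).card + (3 * H + b i) * b i)
    (hS : ∀ i, xS i + b i * ∑ j, b j =
      (Finset.univ.filter fun e => q (ts e) = i).card + (3 * H + b i) * b i)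
    (hnum : IsSmallDeficiency H xS) :
    HasOutline (Sum.elim (fun _ : Fin 3 => H) b) := by
  have hsum : ∀ (p : E → Prop) [DecidablePred p] (t : E → U),
      ∑ l, (Finset.univ.filter fun e => p e ∧ q (t e) = l).card =
        (Finset.univ.filter fun e => p e).card := by
    intro p _ t
    rw [Finset.card_eq_sum_card_fiberwise (f := fun e => q (t e)) (t := Finset.univ) (by simp)]
    simp only [Finset.filter_filter]
  have hsum' : ∀ (p : E → Prop) [DecidablePred p] (t : E → U),
      ∑ l, (Finset.univ.filter fun e => q (t e) = l ∧ p e).card =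
        (Finset.univ.filter fun e => p e).card := by
    intro p _ t
    rw [← hsum p t]
    simp only [and_comm]
  have hpair : ∀ (t t' : E → U), (Function.Injective fun e => (t e, t' e)) → ∀ i j,
      (Finset.univ.filter fun e => q (t e) = i ∧ q (t' e) = j).card ≤ b i * b j := by
    intro t t' ht i j
    rw [← hq i, ← hq j, ← Finset.card_product]
    refine Finset.card_le_card_of_injOn (fun e => (t e, t' e)) ?_ ht.injOn
    intro e he
    simpa using he
  have m1 : ∀ i j, ∑ l, (Finset.univ.filter fun e =>
      q (tr e) = i ∧ q (tc e) = j ∧ q (ts e) = l).card =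
      (Finset.univ.filter fun e => q (tr e) = i ∧ q (tc e) = j).card := by
    intro i j
    rw [← hsum (fun e => q (tr e) = i ∧ q (tc e) = j) ts]
    simp only [and_assoc]
  have m2 : ∀ i l, ∑ j, (Finset.univ.filter fun e =>
      q (tr e) = i ∧ q (tc e) = j ∧ q (ts e) = l).card =
      (Finset.univ.filter fun e => q (tr e) = i ∧ q (ts e) = l).card := by
    intro i l
    rw [← hsum (fun e => q (tr e) = i ∧ q (ts e) = l) tc]
    refine Finset.sum_congr rfl fun j _ => ?_
    congr 1
    ext e
    simp only [Finset.mem_filter]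
    tauto
  have m3 : ∀ j l, ∑ i, (Finset.univ.filter fun e =>
      q (tr e) = i ∧ q (tc e) = j ∧ q (ts e) = l).card =
      (Finset.univ.filter fun e => q (tc e) = j ∧ q (ts e) = l).card := by
    intro j l
    rw [← hsum (fun e => q (tc e) = j ∧ q (ts e) = l) tr]
    refine Finset.sum_congr rfl fun i _ => ?_
    congr 1
    ext e
    simp only [Finset.mem_filter]
    tauto
  refine hasOutline_of_marginals H b
    (fun i j l => (Finset.univ.filter fun e => q (tr e) = i ∧ q (tc e) = j ∧ q (ts e) = l).card)
    _ _ xS ?_ ?_ ?_ ?_ (fun i => Nat.sub_add_cancel ?_) (fun i => Nat.sub_add_cancel ?_) ?_ hnum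
  · intro i j l h
    obtain ⟨e, he⟩ := Finset.card_ne_zero.1 h
    simp only [Finset.mem_filter, Finset.mem_univ, true_and] at he
    obtain ⟨rfl, rfl, rfl⟩ := he
    exact ⟨hrc e, hrs e, hcs e⟩
  · intro i j
    rw [m1]
    exact hpair _ _ irc i j
  · intro i j
    rw [m2]
    exact hpair _ _ irs i j
  · intro i j
    rw [m3]
    exact hpair _ _ ics i j
  · simp only [m1, hsum]
    exact hR i
  · simp only [m1]
    simp only [hsum']
    exact hC i
  · intro l
    simp only [m2]
    simp only [hsum']
    exact hS l

/-! ### Cyclic packings -/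

/-- The points of the small parts in increasing order. -/
theorem exists_monotone_parts {r : ℕ} (b : Fin r → ℕ) (B : ℕ) (hB : ∑ j, b j = B) :
    ∃ q : Fin B → Fin r, Monotone q ∧
      ∀ j, (Finset.univ.filter fun u => q u = j).card = b j := by
  let _ : Fintype (Σₗ j : Fin r, Fin (b j)) := Fintype.ofEquiv (Σ j : Fin r, Fin (b j)) toLex
  have hV : Fintype.card (Σₗ j : Fin r, Fin (b j)) = B := by
    rw [Fintype.ofEquiv_card, Fintype.card_sigma]
    simpa using hB
  let f : Fin B ≃o Σₗ j : Fin r, Fin (b j) := Fintype.orderIsoFinOfCardEq _ hV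
  refine ⟨fun u => (ofLex (f u)).1, ?_, ?_⟩
  · intro u v huv
    have h : f u ≤ f v := f.monotone huv
    rcases Sigma.Lex.le_def.1 h with h | ⟨h, -⟩
    · exact h.le
    · exact h.le
  · intro j
    have e : {u : Fin B // (ofLex (f u)).1 = j} ≃ {v : Σ j : Fin r, Fin (b j) // v.1 = j} :=
      (f.toEquiv.trans ofLex).subtypeEquiv fun u => Iff.rfl
    rw [← Fintype.card_subtype, Fintype.card_congr e,
      Fintype.card_congr (Equiv.sigmaSubtype j), Fintype.card_fin]

/-- Points of the same part are close to each other. -/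
theorem lt_add_of_same_part {r B H : ℕ} {b : Fin r → ℕ} {q : Fin B → Fin r} (hmono : Monotone q)
    (hq : ∀ j, (Finset.univ.filter fun u => q u = j).card = b j) (hb : ∀ j, b j ≤ H)
    {u v : Fin B} (h : q u = q v) : (v : ℕ) < u + H := by
  by_contra! hlt
  have hsub : Finset.Icc u v ⊆ Finset.univ.filter fun x => q x = q u := by
    intro x hx
    rw [Finset.mem_Icc] at hx
    simp only [Finset.mem_filter, Finset.mem_univ, true_and]
    exact le_antisymm ((hmono hx.2).trans h.ge) (hmono hx.1)
  have h1 := Finset.card_le_card hsub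
  rw [hq, Fin.card_Icc] at h1
  have := hb (q u)
  omega

theorem add_mod_cases {B u s : ℕ} (hu : u < B) (hs : s < B) :
    (u + s) % B = u + s ∧ u + s < B ∨ (u + s) % B + B = u + s ∧ B ≤ u + s := by
  rcases lt_or_ge (u + s) B with h | h
  · exact Or.inl ⟨Nat.mod_eq_of_lt h, h⟩
  · right
    rw [Nat.mod_eq_sub_mod h, Nat.mod_eq_of_lt (by omega)]
    omega

/-- Completing the packing formed by the cyclic shifts of `K` base triples
`(0, σ o, τ o)`, where the triples in `Rm` have been removed. -/
theorem hasOutline_of_offsets {r B H K β : ℕ} {b : Fin r → ℕ} (hH : 0 < H) (hb : ∀ j, b j ≤ H)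
    (hβ : ∀ j, β ≤ b j) (hB : ∑ j, b j = B) (hK : 3 * H + β + K = B) {q : Fin B → Fin r}
    (hmono : Monotone q) (hq : ∀ j, (Finset.univ.filter fun u => q u = j).card = b j)
    (sh : Fin B → ℕ → Fin B) (hsh : ∀ u s, (sh u s : ℕ) = (u + s) % B)
    (σ τ δ : Fin K → ℕ) (hσ : ∀ o, H ≤ σ o ∧ σ o + H ≤ B) (hτ : ∀ o, H ≤ τ o ∧ τ o + H ≤ B)
    (hδ : ∀ o, H ≤ δ o ∧ δ o + H ≤ B) (iσ : Function.Injective σ) (iτ : Function.Injective τ)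
    (iδ : Function.Injective δ) (hsum : ∀ o, σ o + δ o = τ o ∨ σ o + δ o = τ o + B)
    (Rm : Fin B × Fin K → Prop) [DecidablePred Rm] (xS : Fin r → ℕ)
    (hR : ∀ i, (Finset.univ.filter fun p => Rm p ∧ q p.1 = i).card ≤ b i * (b i - β))
    (hC : ∀ i, (Finset.univ.filter fun p => Rm p ∧ q (sh p.1 (σ p.2)) = i).card ≤
      b i * (b i - β))
    (hS : ∀ i, xS i + (Finset.univ.filter fun p => Rm p ∧ q (sh p.1 (τ p.2)) = i).card =
      b i * (b i - β))
    (hnum : IsSmallDeficiency H xS) :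
    HasOutline (Sum.elim (fun _ : Fin 3 => H) b) := by
  have hfar : ∀ u s, H ≤ s → s + H ≤ B → q u ≠ q (sh u s) := by
    intro u s h1 h2 h
    have h3 := lt_add_of_same_part hmono hq hb h
    have h4 := lt_add_of_same_part hmono hq hb h.symm
    rw [hsh] at h3 h4
    have := u.2
    rcases add_mod_cases u.2 (show s < B by omega) with h5 | h5 <;> omega
  have hcomp : ∀ u o, sh u (τ o) = sh (sh u (σ o)) (δ o) := by
    intro u o
    apply Fin.ext
    rw [hsh, hsh, hsh, Nat.mod_add_mod, add_assoc]
    rcases hsum o with h | h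
    · rw [h]
    · rw [h, ← add_assoc, Nat.add_mod_right]
  have hinj : ∀ (s : Fin K → ℕ), (∀ o, H ≤ s o ∧ s o + H ≤ B) → Function.Injective s →
      ∀ u o o', sh u (s o) = sh u (s o') → o = o' := by
    intro s hs is u o o' h
    apply is
    have h1 := congrArg Fin.val h
    rw [hsh, hsh] at h1
    have h2 := hs o
    have h3 := hs o'
    have := u.2
    rcases add_mod_cases u.2 (show s o < B by omega) with h5 | h5 <;>
      rcases add_mod_cases u.2 (show s o' < B by omega) with h6 | h6 <;> omega
  have hinj' : ∀ s < B, Function.Injective fun u => sh u s := by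
    intro s hs u u' h
    have h1 := congrArg Fin.val h
    simp only [hsh] at h1
    apply Fin.ext
    have := u.2
    have := u'.2
    rcases add_mod_cases u.2 hs with h5 | h5 <;>
      rcases add_mod_cases u'.2 hs with h6 | h6 <;> omega
  have hcount : ∀ (s : Fin K → ℕ), (∀ o, s o < B) → ∀ i,
      (Finset.univ.filter fun p : Fin B × Fin K => q (sh p.1 (s p.2)) = i).card = K * b i := by
    intro s hs i
    rw [Finset.card_eq_sum_card_fiberwise (f := Prod.snd) (t := Finset.univ) (by simp)]
    rw [Finset.sum_const_nat (m := b i)]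
    · simp
    intro o _
    rw [Finset.filter_filter, ← hq i]
    refine Finset.card_bij (fun p _ => sh p.1 (s o)) ?_ ?_ ?_
    · rintro ⟨u, o'⟩ hp
      simp only [Finset.mem_filter, Finset.mem_univ, true_and] at hp ⊢
      obtain ⟨h1, rfl⟩ := hp
      exact h1
    · rintro ⟨u, o₁⟩ h1 ⟨v, o₂⟩ h2 h
      simp only [Finset.mem_filter, Finset.mem_univ, true_and] at h1 h2
      rw [Prod.mk.injEq]
      exact ⟨hinj' _ (hs o) h, h1.2.trans h2.2.symm⟩
    · intro v hv
      obtain ⟨u, hu⟩ := Finite.injective_iff_surjective.1 (hinj' _ (hs o)) v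
      refine ⟨(u, o), ?_, hu⟩
      simp only [Finset.mem_filter, Finset.mem_univ, true_and, and_true] at hv ⊢
      rw [← hv, ← hu]
  have hcount' : ∀ (t : Fin B × Fin K → Fin B) i,
      (Finset.univ.filter fun p => q (t p) = i).card = K * b i →
      (Finset.univ.filter fun e : {p // ¬ Rm p} => q (t e.1) = i).card +
        (Finset.univ.filter fun p => Rm p ∧ q (t p) = i).card = K * b i := by
    intro t i ht
    rw [← ht, ← Finset.card_filter_add_card_filter_not (s := Finset.univ.filter
      fun p => q (t p) = i) Rm, add_comm]
    congr 1
    · rw [Finset.filter_filter]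
      simp only [and_comm]
    · refine Finset.card_bij (fun e _ => e.1) ?_ ?_ ?_
      · intro e he
        simp only [Finset.mem_filter, Finset.mem_univ, true_and] at he ⊢
        exact ⟨he, e.2⟩
      · intro e _ e' _ h
        exact Subtype.ext h
      · intro p hp
        simp only [Finset.mem_filter, Finset.mem_univ, true_and] at hp
        exact ⟨⟨p, hp.2⟩, by simpa using hp.1, rfl⟩
  have hlt : ∀ s : ℕ, s + H ≤ B → s < B := fun s hs => by omega
  have cR : ∀ i, (Finset.univ.filter fun p : Fin B × Fin K => q p.1 = i).card = K * b i := by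
    intro i
    rw [← hcount (fun _ => 0) (fun _ => by omega) i]
    congr 1
    ext p
    have : sh p.1 0 = p.1 := Fin.ext (by rw [hsh, add_zero, Nat.mod_eq_of_lt p.1.2])
    simp only [Finset.mem_filter, Finset.mem_univ, true_and, this]
  have hfin : ∀ i, b i * B + b i * (b i - β) = K * b i + (3 * H + b i) * b i := by
    intro i
    obtain ⟨d, hd⟩ := Nat.exists_eq_add_of_le (hβ i)
    rw [← hK, hd, Nat.add_sub_cancel_left]
    ring
  refine hasOutline_of_triples H b q hq (E := {p : Fin B × Fin K // ¬ Rm p}) (fun e => e.1.1)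
    (fun e => sh e.1.1 (σ e.1.2)) (fun e => sh e.1.1 (τ e.1.2)) (fun e => ?_) (fun e => ?_)
    (fun e => ?_) ?_ ?_ ?_ xS (fun i => ?_) (fun i => ?_) (fun i => ?_) hnum
  · exact hfar _ _ (hσ _).1 (hσ _).2
  · exact hfar _ _ (hτ _).1 (hτ _).2
  · simp only [hcomp]
    exact hfar _ _ (hδ _).1 (hδ _).2
  · rintro ⟨⟨u, o⟩, h1⟩ ⟨⟨v, o'⟩, h2⟩ h
    simp only [Prod.mk.injEq] at h
    obtain ⟨rfl, h⟩ := h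
    simp only [hinj σ hσ iσ _ _ _ h]
  · rintro ⟨⟨u, o⟩, h1⟩ ⟨⟨v, o'⟩, h2⟩ h
    simp only [Prod.mk.injEq] at h
    obtain ⟨rfl, h⟩ := h
    simp only [hinj τ hτ iτ _ _ _ h]
  · rintro ⟨⟨u, o⟩, h1⟩ ⟨⟨v, o'⟩, h2⟩ h
    simp only [Prod.mk.injEq, hcomp] at h
    obtain ⟨h3, h4⟩ := h
    rw [h3] at h4
    have := hinj δ hδ iδ _ _ _ h4
    subst this
    simp only [hinj' _ (hlt _ (hσ o).2) h3]
  · have h1 := hcount' (fun p => p.1) i (cR i)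
    have h2 := hR i
    have h3 := hfin i
    rw [hB]
    omega
  · have h1 := hcount' (fun p => sh p.1 (σ p.2)) i (hcount σ (fun o => hlt _ (hσ o).2) i)
    have h2 := hC i
    have h3 := hfin i
    rw [hB]
    omega
  · have h1 := hcount' (fun p => sh p.1 (τ p.2)) i (hcount τ (fun o => hlt _ (hτ o).2) i)
    have h2 := hS i
    have h3 := hfin i
    rw [hB]
    omega

/-- Base triples whose three differences are pairwise distinct across triples and avoid the
short distances. -/
theorem exists_offsets (H B K : ℕ) (hK : 3 * H + 1 + K ≤ B) :
    ∃ σ τ δ : Fin K → ℕ, (∀ o, H ≤ σ o ∧ σ o + H ≤ B) ∧ (∀ o, H ≤ τ o ∧ τ o + H ≤ B) ∧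
      (∀ o, H ≤ δ o ∧ δ o + H ≤ B) ∧ Function.Injective σ ∧ Function.Injective τ ∧
      Function.Injective δ ∧ (∀ o, σ o + δ o = τ o ∨ σ o + δ o = τ o + B) ∧
      ∀ o : Fin K, (o : ℕ) ≤ (B - H) / 2 - H → σ o = H + o ∧ τ o = 2 * (H + o) := by
  let P := (B - H) / 2 - H + 1
  let ρ : ℕ → ℕ := fun o => H + (B + 1) % 2 + (o - P)
  refine ⟨fun o => if (o : ℕ) < P then H + o else B - ρ o,
    fun o => if (o : ℕ) < P then 2 * (H + o) else B - 2 * ρ o + (B + 1) % 2,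
    fun o => if (o : ℕ) < P then H + o else B - ρ o + (B + 1) % 2,
    ?_, ?_, ?_, ?_, ?_, ?_, ?_, ?_⟩
  · intro o
    have := o.2
    simp only [ρ, P]
    split_ifs <;> omega
  · intro o
    have := o.2
    simp only [ρ, P]
    split_ifs <;> omega
  · intro o
    have := o.2
    simp only [ρ, P]
    split_ifs <;> omega
  · intro o o' h
    have := o.2
    have := o'.2
    apply Fin.ext
    simp only [ρ, P] at h
    split_ifs at h <;> omega
  · intro o o' h
    have := o.2
    have := o'.2
    apply Fin.ext
    simp only [ρ, P] at h
    split_ifs at h <;> omega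
  · intro o o' h
    have := o.2
    have := o'.2
    apply Fin.ext
    simp only [ρ, P] at h
    split_ifs at h <;> omega
  · intro o
    have := o.2
    simp only [ρ, P]
    split_ifs <;> omega
  · intro o ho
    have : (o : ℕ) < P := by simp only [P]; omega
    simp only [this, if_true, and_self]

/-- The case in which the parts are many but the total is not too large. -/
theorem hasOutline_of_sum_le {r B H β : ℕ} {b : Fin r → ℕ} (hβ0 : 0 < β) (hb : ∀ j, b j ≤ H)
    (hβ : ∀ j, β ≤ b j) (hB : ∑ j, b j = B) (hK : 3 * H + β ≤ B) (hle : B + 6 ≤ 6 * H) :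
    HasOutline (Sum.elim (fun _ : Fin 3 => H) b) := by
  have hH : 0 < H := by omega
  obtain ⟨K, hK⟩ := Nat.exists_eq_add_of_le hK
  obtain ⟨q, hmono, hq⟩ := exists_monotone_parts b B hB
  obtain ⟨σ, τ, δ, hσ, hτ, hδ, iσ, iτ, iδ, hsum, -⟩ := exists_offsets H B K (by omega)
  refine hasOutline_of_offsets hH hb hβ hB hK.symm hmono hq
    (fun u s => ⟨(u + s) % B, Nat.mod_lt _ u.pos⟩) (fun _ _ => rfl) σ τ δ hσ hτ hδ iσ iτ iδ hsum
    (fun _ => False) (fun l => b l * (b l - β)) (by simp) (by simp) (by simp) (.of_le hH ?_)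
  have hpart : ∀ l, (H + 1) * (b l * (b l - β)) +
      5 * H * (if b l * (b l - β) = 0 then 0 else 1) ≤ (H * H + 4) * b l := by
    intro l
    split_ifs with h0
    · rw [h0]
      omega
    · have h1 : b l - β ≠ 0 := right_ne_zero_of_mul h0
      obtain ⟨c, hc⟩ : ∃ c, b l = c + 2 := ⟨b l - 2, by omega⟩
      obtain ⟨d, hd⟩ := Nat.exists_eq_add_of_le (hb l)
      have h2 : b l * (b l - β) ≤ b l * (c + 1) := Nat.mul_le_mul_left _ (by omega)
      have h3 := Nat.mul_le_mul_left (H + 1) h2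
      refine (Nat.add_le_add_right h3 _).trans ?_
      rw [hd, hc]
      nlinarith [Nat.zero_le (c * d * c), Nat.zero_le (c * d * d), Nat.zero_le (c * d),
        Nat.zero_le (d * d)]
  have h1 := Finset.sum_le_sum fun l (_ : l ∈ Finset.univ) => hpart l
  rw [Finset.sum_add_distrib, ← Finset.mul_sum, ← Finset.mul_sum, ← Finset.mul_sum, hB] at h1
  refine h1.trans ?_
  have h2 := Nat.mul_le_mul_left (H * H + 4) hle
  obtain ⟨n, rfl⟩ : ∃ n, H = n + 1 := ⟨H - 1, by omega⟩
  nlinarith [sq_nonneg ((n : ℤ) - 1)]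

/-- The deficiency left by the points that come too early to be the third point of one of the
removed triples. -/
theorem isSmallDeficiency_of_early {r B K H β : ℕ} {b : Fin r → ℕ} (hH : 0 < H) (hβ0 : 0 < β)
    (hb : ∀ j, b j ≤ H) (q : Fin B → Fin r) :
    IsSmallDeficiency H fun i => (Finset.univ.filter fun p : Fin B × Fin K =>
      (q p.1 = i ∧ (p.2 : ℕ) + β < b i) ∧ (p.1 : ℕ) < 2 * (H + p.2)).card := by
  obtain ⟨n, rfl⟩ : ∃ n, H = n + 1 := ⟨H - 1, by omega⟩
  set xS : Fin r → ℕ := fun i => (Finset.univ.filter fun p : Fin B × Fin K =>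
    (q p.1 = i ∧ (p.2 : ℕ) + β < b i) ∧ (p.1 : ℕ) < 2 * (n + 1 + p.2)).card
  refine .of_le hH ?_
  have hmem : ∀ i (p : Fin B × Fin K), (p.2 : ℕ) + β < b i → (p.2 : ℕ) < n := by
    intro i p h
    have := hb i
    omega
  have hD : ∑ i, xS i ≤ ∑ o ∈ Finset.range n, 2 * (n + 1 + o) := by
    simp only [xS]
    rw [← Finset.card_biUnion]
    · rw [← Finset.sum_congr rfl fun o _ => Finset.card_range (2 * (n + 1 + o)),
        ← Finset.card_sigma]
      refine Finset.card_le_card_of_injOn (fun p => ⟨(p.2 : ℕ), (p.1 : ℕ)⟩) ?_ ?_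
      · intro p hp
        simp only [Finset.coe_biUnion, Set.mem_iUnion, Finset.mem_coe, Finset.mem_filter,
          Finset.mem_univ, true_and, Finset.mem_sigma, Finset.mem_range] at hp ⊢
        obtain ⟨i, -, hi, hlt⟩ := hp
        exact ⟨hmem i p hi.2, hlt⟩
      · intro p _ p' _ h
        simp only [Sigma.mk.injEq, heq_eq_eq] at h
        exact Prod.ext (Fin.ext h.2) (Fin.ext h.1)
    · intro i _ j _ hij
      rw [Function.onFun, Finset.disjoint_left]
      intro p h1 h2
      simp only [Finset.mem_filter, Finset.mem_univ, true_and] at h1 h2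
      exact hij (h1.1.1.symm.trans h2.1.1)
  have hN : ∑ i, (if xS i = 0 then 0 else 1) ≤ 4 * n := by
    have h1 : ∑ i, (if xS i = 0 then 0 else 1) = (Finset.univ.filter fun i => xS i ≠ 0).card := by
      rw [Finset.card_filter]
      exact Finset.sum_congr rfl fun i _ => by split_ifs <;> simp_all
    have h2 : (Finset.univ.filter fun i => xS i ≠ 0) ⊆
        (Finset.univ.filter fun u : Fin B => (u : ℕ) < 4 * n).image q := by
      intro i hi
      simp only [Finset.mem_filter, Finset.mem_univ, true_and, xS, Finset.card_ne_zero] at hi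
      obtain ⟨p, hp⟩ := hi
      simp only [Finset.mem_filter, Finset.mem_univ, true_and] at hp
      rw [Finset.mem_image]
      refine ⟨p.1, ?_, hp.1.1⟩
      have := hmem i p hp.1.2
      simp only [Finset.mem_filter, Finset.mem_univ, true_and]
      omega
    rw [h1]
    refine (Finset.card_le_card h2).trans (Finset.card_image_le.trans ?_)
    rw [← Finset.card_range (4 * n)]
    exact Finset.card_le_card_of_injOn Fin.val (by intro u hu; simpa using hu)
      fun u _ v _ h => Fin.ext h
  have hsumD : ∀ m, ∑ o ∈ Finset.range m, 2 * (n + 1 + o) = 2 * (n + 1) * m + m * (m - 1) := by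
    intro m
    induction m with
    | zero => simp
    | succ m ih =>
      rw [Finset.sum_range_succ, ih, Nat.add_sub_cancel]
      cases m with
      | zero => ring
      | succ m => rw [Nat.add_sub_cancel]; ring
  rw [hsumD] at hD
  have h1 := Nat.mul_le_mul_left (n + 1 + 1) hD
  have h2 := Nat.mul_le_mul_left (5 * (n + 1)) hN
  refine (Nat.add_le_add h1 h2).trans ?_
  cases n with
  | zero => simp
  | succ n =>
    rw [Nat.add_sub_cancel]
    cases n with
    | zero => norm_num
    | succ n =>
      nlinarith [mul_nonneg (Nat.cast_nonneg (α := ℤ) n) (sq_nonneg ((n : ℤ)))]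

/-- The case in which the total is large. -/
theorem hasOutline_of_le_sum {r B H β : ℕ} {b : Fin r → ℕ} (hβ0 : 0 < β) (hanti : Antitone b)
    (hb : ∀ j, b j ≤ H) (hβ : ∀ j, β ≤ b j) (hB : ∑ j, b j = B) (hH : 0 < H)
    (hK : 3 * H + β < B) (hle : 6 * H ≤ B + 5) :
    HasOutline (Sum.elim (fun _ : Fin 3 => H) b) := by
  obtain ⟨K, hK'⟩ := Nat.exists_eq_add_of_le hK.le
  obtain ⟨q, hmono, hq⟩ := exists_monotone_parts b B hB
  obtain ⟨σ, τ, δ, hσ, hτ, hδ, iσ, iτ, iδ, hsum, hst⟩ := exists_offsets H B K (by omega)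
  let sh : Fin B → ℕ → Fin B := fun u s => ⟨(u + s) % B, Nat.mod_lt _ u.pos⟩
  have hshv : ∀ (u : Fin B) (s : ℕ), (u : ℕ) + s < B → (sh u s : ℕ) = u + s :=
    fun u s h => Nat.mod_eq_of_lt h
  let Rm : Fin B × Fin K → Prop := fun p =>
    (p.1 : ℕ) + 2 * (H + p.2) < B ∧ (p.2 : ℕ) + β < b (q (sh p.1 (2 * (H + p.2))))
  have hRm : ∀ p, Rm p → σ p.2 = H + p.2 ∧ τ p.2 = 2 * (H + p.2) := by
    rintro p ⟨h1, h2⟩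
    have := hb (q (sh p.1 (2 * (H + p.2))))
    exact hst p.2 (by omega)
  have hle_b : ∀ p s, Rm p → s ≤ 2 * (H + (p.2 : ℕ)) → (p.2 : ℕ) + β < b (q (sh p.1 s)) := by
    rintro p s ⟨h1, h2⟩ hs
    refine h2.trans_le (hanti (hmono ?_))
    rw [Fin.le_def, hshv _ _ (by omega), hshv _ _ h1]
    omega
  have hprod : ∀ i (s : Finset (Fin B × Fin K)) (f : Fin B × Fin K → Fin B),
      (∀ p ∈ s, q (f p) = i ∧ (p.2 : ℕ) + β < b i) →
      (∀ p ∈ s, ∀ p' ∈ s, p.2 = p'.2 → f p = f p' → p = p') → s.card ≤ b i * (b i - β) := by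
    intro i s f hf hinj
    rw [← hq i]
    nth_rw 2 [hq i]
    rw [← Finset.card_range (b i - β), ← Finset.card_product]
    refine Finset.card_le_card_of_injOn (fun p => (f p, (p.2 : ℕ))) ?_ ?_
    · intro p hp
      have := hf p hp
      simp only [Finset.coe_product, Set.mem_prod, Finset.mem_coe, Finset.mem_filter,
        Finset.mem_univ, true_and, Finset.mem_range]
      exact ⟨this.1, by omega⟩
    · intro p hp p' hp' h
      rw [Prod.mk.injEq] at h
      exact hinj p hp p' hp' (Fin.ext h.2) h.1
  let xS : Fin r → ℕ := fun i => (Finset.univ.filter fun p : Fin B × Fin K =>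
    (q p.1 = i ∧ (p.2 : ℕ) + β < b i) ∧ (p.1 : ℕ) < 2 * (H + p.2)).card
  have hall : ∀ i, (Finset.univ.filter fun p : Fin B × Fin K =>
      q p.1 = i ∧ (p.2 : ℕ) + β < b i).card = b i * (b i - β) := by
    intro i
    have hlt : b i - β ≤ K := by
      have := hb i
      omega
    have h1 : (Finset.univ.filter fun o : Fin K => (o : ℕ) + β < b i).card = b i - β := by
      rw [← Finset.card_range (b i - β), ← Finset.card_map Fin.valEmbedding]
      congr 1
      ext o
      simp only [Finset.mem_map, Finset.mem_filter, Finset.mem_univ, true_and, Finset.mem_range,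
        Fin.valEmbedding_apply]
      constructor
      · rintro ⟨o, h, rfl⟩
        omega
      · intro h
        exact ⟨⟨o, by omega⟩, by simp only; omega, rfl⟩
    have h2 := Finset.card_product (Finset.univ.filter fun u => q u = i)
      (Finset.univ.filter fun o : Fin K => (o : ℕ) + β < b i)
    rw [hq, h1, ← Finset.filter_product, Finset.univ_product_univ] at h2
    exact h2
  refine hasOutline_of_offsets hH hb hβ hB hK'.symm hmono hq sh (fun _ _ => rfl) σ τ δ hσ hτ hδ
    iσ iτ iδ hsum Rm xS (fun i => ?_) (fun i => ?_) (fun i => ?_)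
    (isSmallDeficiency_of_early hH hβ0 hb q)
  · refine hprod i _ Prod.fst ?_ ?_
    · intro p hp
      simp only [Finset.mem_filter, Finset.mem_univ, true_and] at hp
      have h1 := hle_b p 0 hp.1 (Nat.zero_le _)
      have h2 : sh p.1 0 = p.1 := Fin.ext (hshv p.1 0 (by omega))
      rw [h2, hp.2] at h1
      exact ⟨hp.2, h1⟩
    · intro p _ p' _ h1 h2
      exact Prod.ext h2 h1
  · refine hprod i _ (fun p => sh p.1 (σ p.2)) ?_ ?_
    · intro p hp
      simp only [Finset.mem_filter, Finset.mem_univ, true_and] at hp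
      have h1 := hle_b p (σ p.2) hp.1 (by have := (hRm p hp.1).1; omega)
      rw [hp.2] at h1
      exact ⟨hp.2, h1⟩
    · intro p hp p' hp' h1 h2
      simp only [Finset.mem_filter, Finset.mem_univ, true_and] at hp hp'
      have h3 := congrArg Fin.val h2
      have h4 := hp.1.1
      have h5 := hp'.1.1
      rw [(hRm p hp.1).1, (hRm p' hp'.1).1, hshv _ _ (by omega), hshv _ _ (by omega), h1] at h3
      exact Prod.ext (Fin.ext (by omega)) h1
  · rw [← hall i, ← Finset.card_filter_add_card_filter_not (s := Finset.univ.filter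
      fun p : Fin B × Fin K => q p.1 = i ∧ (p.2 : ℕ) + β < b i)
      (fun p => (p.1 : ℕ) < 2 * (H + p.2)), Finset.filter_filter, Finset.filter_filter]
    congr 1
    refine Finset.card_bij (fun p _ => (sh p.1 (τ p.2), p.2)) ?_ ?_ ?_
    · intro p hp
      simp only [Finset.mem_filter, Finset.mem_univ, true_and] at hp ⊢
      obtain ⟨h1, h2⟩ := hp
      have h3 := (hRm p h1).2
      have h4 := hle_b p (τ p.2) h1 h3.le
      rw [h2] at h4
      refine ⟨⟨h2, h4⟩, ?_⟩
      rw [h3, hshv _ _ h1.1]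
      omega
    · intro p hp p' hp' h
      simp only [Finset.mem_filter, Finset.mem_univ, true_and] at hp hp'
      rw [Prod.mk.injEq] at h
      obtain ⟨h2, h1⟩ := h
      have h3 := congrArg Fin.val h2
      rw [(hRm p hp.1).2, (hRm p' hp'.1).2, hshv _ _ hp.1.1, hshv _ _ hp'.1.1, h1] at h3
      exact Prod.ext (Fin.ext (by omega)) h1
    · rintro ⟨v, o⟩ hp
      simp only [Finset.mem_filter, Finset.mem_univ, true_and, not_lt] at hp
      obtain ⟨⟨h1, h2⟩, h3⟩ := hp
      let u : Fin B := ⟨v - 2 * (H + o), by omega⟩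
      have hu : sh u (2 * (H + o)) = v := by
        apply Fin.ext
        rw [hshv _ _ (by simp only [u]; omega)]
        simp only [u]
        omega
      have hRu : Rm (u, o) := by
        refine ⟨by simp only [u]; omega, ?_⟩
        simp only [hu, h1]
        exact h2
      refine ⟨(u, o), ?_, ?_⟩
      · simp only [Finset.mem_filter, Finset.mem_univ, true_and]
        refine ⟨hRu, ?_⟩
        rw [(hRm _ hRu).2, hu, h1]
      · rw [(hRm _ hRu).2, hu]

/-! ### Few small parts -/

theorem hasOutline_of_cells {I : Type*} [Fintype I] [DecidableEq I] (c : I → I → List I)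
    {w : I → ℕ} (h1 : ∀ i j, ∑ l, (c i j).count l = w i * w j)
    (h2 : ∀ i l, ∑ j, (c i j).count l = w i * w l) (h3 : ∀ j l, ∑ i, (c i j).count l = w j * w l)
    (h4 : ∀ i l, l ≠ i → (c i i).count l = 0) : HasOutline w :=
  ⟨fun i j l => (c i j).count l, h1, h2, h3, h4⟩

/-- Whether an outline exists only depends on the number of parts of each size. -/
theorem HasOutline.of_card_eq {I J : Type*} [Fintype I] [Fintype J] {w : I → ℕ} {H : ℕ} {b : J → ℕ}
    (h : HasOutline w) (hc : ∀ c, (Finset.univ.filter fun i => w i = c).card =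
      (if H = c then 3 else 0) + (Finset.univ.filter fun j => b j = c).card) :
    HasOutline (Sum.elim (fun _ : Fin 3 => H) b) := by
  have hcard : ∀ c, (Finset.univ.filter fun i => Sum.elim (fun _ : Fin 3 => H) b i = c).card =
      (Finset.univ.filter fun i => w i = c).card := by
    intro c
    rw [hc, Finset.card_filter, Fintype.sum_sum_type, Finset.card_filter]
    change (∑ _ : Fin 3, if H = c then 1 else 0) + (∑ j, if b j = c then 1 else 0) = _
    rw [Finset.sum_const, Finset.card_univ, Fintype.card_fin, smul_eq_mul, mul_ite, mul_one,
      mul_zero]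
  let e := Equiv.ofFiberEquiv (f := Sum.elim (fun _ : Fin 3 => H) b) (g := w) fun c =>
    Fintype.equivOfCardEq (by rw [Fintype.card_subtype, Fintype.card_subtype, hcard])
  exact h.congr e fun i => (Equiv.ofFiberEquiv_map _ i).symm

theorem hasOutline_five_ones : HasOutline fun _ : Fin 5 => 1 :=
  hasOutline_of_cells (fun i j => [3 * (i + j)]) (by decide) (by decide) (by decide) (by decide)

theorem hasOutline_six_ones : HasOutline fun _ : Fin 6 => 1 :=
  hasOutline_of_cells
    (![![[0], [5], [3], [2], [1], [4]],
        ![[3], [1], [4], [5], [0], [2]],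
        ![[4], [3], [2], [1], [5], [0]],
        ![[5], [4], [0], [3], [2], [1]],
        ![[1], [2], [5], [0], [4], [3]],
        ![[2], [0], [1], [4], [3], [5]]] : Fin 6 → Fin 6 → List (Fin 6))
    (by decide) (by decide) (by decide) (by decide)

theorem hasOutline_three_twos_five_ones :
    HasOutline fun i : Fin 8 => if (i : ℕ) < 3 then 2 else 1 :=
  hasOutline_of_cells
    (![![[0, 0, 0, 0], [2, 3, 3, 4], [5, 5, 6, 6], [2, 7], [1, 7], [1, 2], [1, 4], [1, 2]],
        ![[2, 2, 2, 6], [1, 1, 1, 1], [3, 4, 7, 7], [5, 6], [0, 5], [0, 4], [0, 3], [0, 2]],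
        ![[3, 4, 5, 7], [4, 5, 6, 7], [2, 2, 2, 2], [1, 1], [0, 6], [0, 3], [0, 1], [0, 1]],
        ![[2, 5], [6, 7], [0, 0], [3], [1], [1], [2], [4]],
        ![[6, 7], [0, 5], [1, 1], [0], [4], [2], [2], [3]],
        ![[3, 4], [0, 0], [1, 1], [2], [2], [5], [7], [6]],
        ![[1, 1], [0, 2], [3, 4], [0], [2], [7], [6], [5]],
        ![[1, 1], [2, 2], [0, 0], [4], [3], [6], [5], [7]]] : Fin 8 → Fin 8 → List (Fin 8))
    (by decide +kernel) (by decide +kernel) (by decide +kernel) (by decide +kernel)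

theorem hasOutline_four_twos_four_ones :
    HasOutline fun i : Fin 8 => if (i : ℕ) < 4 then 2 else 1 :=
  hasOutline_of_cells
    (![![[0, 0, 0, 0], [3, 3, 4, 5], [4, 5, 6, 6], [1, 2, 2, 7], [2, 7], [1, 3], [1, 3], [1, 2]],
        ![[2, 3, 4, 7], [1, 1, 1, 1], [3, 3, 3, 7], [0, 2, 5, 6], [5, 6], [0, 2], [2, 4], [0, 0]],
        ![[4, 5, 6, 7], [3, 3, 6, 7], [2, 2, 2, 2], [0, 1, 1, 5], [0, 0], [3, 4], [0, 1], [1, 3]],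
        ![[1, 2, 2, 6], [4, 5, 6, 7], [0, 0, 5, 7], [3, 3, 3, 3], [1, 1], [0, 1], [0, 2], [2, 4]],
        ![[2, 5], [0, 0], [1, 1], [6, 7], [4], [2], [3], [3]],
        ![[1, 3], [0, 0], [3, 4], [1, 2], [2], [5], [7], [6]],
        ![[1, 3], [2, 2], [0, 1], [0, 4], [3], [7], [6], [5]],
        ![[1, 3], [2, 2], [0, 1], [0, 4], [3], [6], [5], [7]]] : Fin 8 → Fin 8 → List (Fin 8))
    (by decide +kernel) (by decide +kernel) (by decide +kernel) (by decide +kernel)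

theorem hasOutline_three_twos_six_ones :
    HasOutline fun i : Fin 9 => if (i : ℕ) < 3 then 2 else 1 :=
  hasOutline_of_cells
    (![![[0, 0, 0, 0], [2, 3, 4, 8], [3, 5, 6, 7], [4, 5], [6, 7], [2, 8], [1, 1], [1, 2], [1, 2]],
        ![[2, 3, 4, 4], [1, 1, 1, 1], [5, 6, 7, 8], [6, 8], [2, 3], [2, 7], [2, 5], [0, 0], [0, 0]],
        ![[5, 5, 6, 8], [3, 4, 7, 8], [2, 2, 2, 2], [1, 7], [0, 1], [0, 6], [0, 0], [1, 4], [1, 3]],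
        ![[1, 6], [0, 7], [0, 8], [3], [2], [1], [4], [5], [2]],
        ![[7, 8], [0, 6], [0, 1], [2], [4], [1], [3], [2], [5]],
        ![[1, 7], [2, 6], [0, 1], [0], [8], [5], [2], [3], [4]],
        ![[2, 3], [2, 5], [1, 4], [0], [1], [0], [6], [8], [7]],
        ![[2, 2], [0, 5], [1, 4], [1], [0], [3], [8], [7], [6]],
        ![[1, 1], [0, 2], [0, 3], [2], [5], [4], [7], [6], [8]]] : Fin 9 → Fin 9 → List (Fin 9))
    (by decide +kernel) (by decide +kernel) (by decide +kernel) (by decide +kernel)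

theorem sum_comp_eq_of_le_three {r : ℕ} {b : Fin r → ℕ} (h1 : ∀ l, 1 ≤ b l) (h3 : ∀ l, b l ≤ 3)
    (F : ℕ → ℕ) : ∑ l, F (b l) = (Finset.univ.filter fun l => b l = 1).card * F 1 +
      (Finset.univ.filter fun l => b l = 2).card * F 2 +
      (Finset.univ.filter fun l => b l = 3).card * F 3 := by
  simp only [Finset.card_filter, Finset.sum_mul, ← Finset.sum_add_distrib]
  refine Finset.sum_congr rfl fun l _ => ?_
  have := h1 l
  have := h3 l
  obtain h | h | h : b l = 1 ∨ b l = 2 ∨ b l = 3 := by omega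
  all_goals simp [h]

/-- The parts consist of `a` ones, `d` twos and `e` threes, the total is small, and the empty
packing is expected to be good enough. -/
def IsFewParts (H a d e : ℕ) : Prop :=
  0 < H ∧ (0 < d → 2 ≤ H) ∧ (0 < e → 3 ≤ H) ∧ (0 < a → a + 2 * d + 3 * e ≤ 3 * H + 1) ∧
    (0 < d → a + 2 * d + 3 * e ≤ 3 * H + 2) ∧ (0 < e → a + 2 * d + 3 * e ≤ 3 * H + 3) ∧
    ¬ (H = 1 ∧ (a = 2 ∨ a = 3)) ∧
    ¬ (H = 2 ∧ (a = 5 ∧ d = 0 ∨ a = 4 ∧ d = 1 ∨ a = 6 ∧ d = 0))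

/-- `IsSmallDeficiency` for the empty packing and `a` ones, `d` twos and `e` threes. -/
def IsSmallEmpty (H a d e : ℕ) : Prop :=
  let x : ℕ → ℕ := fun v => v * (3 * H + v - (a + 2 * d + 3 * e))
  let y : ℕ → ℕ := fun v => if 3 * H ∣ x v then 0 else 1
  let z : ℕ → ℕ := fun v => x v / (3 * H)
  (a * x 1 + d * x 2 + e * x 3) + 5 * (a * y 1 + d * y 2 + e * y 3) +
      3 * (H % 2) * (a * z 1 + d * z 2 + e * z 3) ≤ 6 * (H * H) + 5 ∨
    (H + 1) / 2 * ((a * z 1 + d * z 2 + e * z 3) + (a * y 1 + d * y 2 + e * y 3)) ≤ H * H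

instance (H a d e : ℕ) : Decidable (IsFewParts H a d e) := by
  unfold IsFewParts
  infer_instance

instance (H a d e : ℕ) : Decidable (IsSmallEmpty H a d e) := by
  unfold IsSmallEmpty
  infer_instance

theorem isSmallEmpty_of_isFewParts : ∀ H < 4, ∀ a < 13, ∀ d < 7, ∀ e < 5,
    ¬ IsFewParts H a d e ∨ IsSmallEmpty H a d e := by
  decide +kernel

/-- The empty packing is good enough if the parts are large. -/
theorem isSmallDeficiency_of_four_le {r H : ℕ} {b : Fin r → ℕ} (hH : 4 ≤ H) (h1 : ∀ l, 1 ≤ b l)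
    (hb : ∀ l, b l ≤ H) (hB : ∀ l, ∑ j, b j ≤ 3 * H + b l) :
    IsSmallDeficiency H fun l => b l * (3 * H + b l - ∑ j, b j) := by
  refine .of_le (by omega) ?_
  set B := ∑ j, b j with hBdef
  have hpart : ∀ l, (H + 1) * (b l * (3 * H + b l - B)) +
      5 * H * (if b l * (3 * H + b l - B) = 0 then 0 else 1) + (H + 1) * B * b l ≤
      (4 * H * H + 4 * H + 5) * b l := by
    intro l
    have h2 : (if b l * (3 * H + b l - B) = 0 then 0 else 1) ≤ 1 := by split_ifs <;> omega
    have h3 := Nat.mul_le_mul_left (5 * H) h2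
    have h4 : b l * (3 * H + b l - B) + B * b l = b l * (3 * H + b l) := by
      rw [mul_comm B, ← mul_add, Nat.sub_add_cancel (hB l)]
    have h5 : (H + 1) * (b l * (3 * H + b l - B)) + (H + 1) * B * b l =
        (H + 1) * (b l * (3 * H + b l)) := by
      rw [← h4]
      ring
    have h6 : (H + 1) * (b l * (3 * H + b l)) + 5 * H ≤ (4 * H * H + 4 * H + 5) * b l := by
      obtain ⟨c, hc⟩ := Nat.exists_eq_add_of_le (h1 l)
      obtain ⟨d, hd⟩ := Nat.exists_eq_add_of_le (hb l)
      have : 5 ≤ (H + 1) * b l := by nlinarith [h1 l]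
      obtain ⟨f, hf⟩ := Nat.exists_eq_add_of_le this
      have h7 : 5 * d ≤ d * ((H + 1) * b l) := by nlinarith
      nlinarith
    omega
  have h2 := Finset.sum_le_sum fun l (_ : l ∈ Finset.univ) => hpart l
  rw [Finset.sum_add_distrib, Finset.sum_add_distrib, ← Finset.mul_sum, ← Finset.mul_sum,
    ← Finset.mul_sum, ← Finset.mul_sum, ← hBdef] at h2
  have h3 : (4 * H * H + 4 * H + 5) * B ≤ H * (6 * (H * H) + 5) + (H + 1) * B * B := by
    obtain ⟨n, rfl⟩ := Nat.exists_eq_add_of_le hH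
    zify
    have h4 : (0 : ℤ) ≤ 4 * (4 + n + 1) * ((4 + n) * (6 * ((4 + n) * (4 + n)) + 5) +
        (4 + n + 1) * B * B - (4 * (4 + n) * (4 + n) + 4 * (4 + n) + 5) * B) := by
      have h5 : 4 * (4 + n + 1) * ((4 + n) * (6 * ((4 + n) * (4 + n)) + 5) +
          (4 + n + 1) * B * B - (4 * (4 + n) * (4 + n) + 4 * (4 + n) + 5) * B) =
          (2 * (4 + n + 1) * B - (4 * (4 + n) * (4 + n) + 4 * (4 + n) + 5) : ℤ) ^ 2 +
          (8 * n ^ 4 + 120 * n ^ 3 + 636 * n ^ 2 + 1356 * n + 855) := by ring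
      rw [h5]
      positivity
    have h6 := nonneg_of_mul_nonneg_right h4 (by positivity)
    linarith
  omega

/-- The case in which the packing is empty. -/
theorem hasOutline_of_few_parts {r H : ℕ} {b : Fin r → ℕ} (hH : 0 < H) (h1 : ∀ l, 1 ≤ b l)
    (hb : ∀ l, b l ≤ H) (hB : ∀ l, ∑ j, b j ≤ 3 * H + b l) :
    HasOutline (Sum.elim (fun _ : Fin 3 => H) b) := by
  suffices h : HasOutline (Sum.elim (fun _ : Fin 3 => H) b) ∨
      IsSmallDeficiency H fun l => b l * (3 * H + b l - ∑ j, b j) by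
    refine h.elim id fun h => ?_
    have hx : ∀ i, b i * (3 * H + b i - ∑ j, b j) + b i * ∑ j, b j = (3 * H + b i) * b i := by
      intro i
      rw [← mul_add, Nat.sub_add_cancel (hB i), mul_comm]
    refine hasOutline_of_marginals H b (fun _ _ _ => 0) _ _ _ (by simp) (by simp) (by simp)
      (by simp) (by simpa using hx) (by simpa using hx) (by simpa using hx) h
  rcases le_or_gt 4 H with h4 | h4
  · exact Or.inr (isSmallDeficiency_of_four_le h4 h1 hb hB)
  have h3 : ∀ l, b l ≤ 3 := fun l => (hb l).trans (by omega)
  have hsum := sum_comp_eq_of_le_three h1 h3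
  have hS := hsum fun v => v
  have hmem : ∀ c, 0 < (Finset.univ.filter fun l => b l = c).card → ∃ l, b l = c := by
    intro c hc
    obtain ⟨l, hl⟩ := Finset.card_pos.1 hc
    exact ⟨l, (Finset.mem_filter.1 hl).2⟩
  have hle : ∀ c, 0 < (Finset.univ.filter fun l => b l = c).card → c ≤ H ∧ ∑ j, b j ≤ 3 * H + c := by
    intro c hc
    obtain ⟨l, rfl⟩ := hmem c hc
    exact ⟨hb l, hB l⟩
  have hzero : ∀ c, c = 0 ∨ 3 < c → (Finset.univ.filter fun l => b l = c).card = 0 := by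
    intro c hc
    by_contra h
    obtain ⟨l, rfl⟩ := hmem c (Nat.pos_of_ne_zero h)
    have := h1 l
    have := h3 l
    omega
  have e1 := hle 1
  have e2 := hle 2
  have e3 := hle 3
  by_cases hx1 : H = 1 ∧ ((Finset.univ.filter fun l => b l = 1).card = 2 ∨
      (Finset.univ.filter fun l => b l = 1).card = 3)
  · left
    obtain ⟨rfl, hx⟩ := hx1
    have hz : ∀ c, c ≠ 1 → (Finset.univ.filter fun l => b l = c).card = 0 := by
      intro c hc
      by_contra h
      obtain ⟨l, rfl⟩ := hmem c (Nat.pos_of_ne_zero h)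
      have := h1 l
      have := hb l
      omega
    rcases hx with hx | hx
    · refine hasOutline_five_ones.of_card_eq fun c => ?_
      rcases eq_or_ne c 1 with rfl | hc
      · rw [hx]; rfl
      · rw [hz c hc, if_neg hc.symm]; simp [hc.symm]
    · refine hasOutline_six_ones.of_card_eq fun c => ?_
      rcases eq_or_ne c 1 with rfl | hc
      · rw [hx]; rfl
      · rw [hz c hc, if_neg hc.symm]; simp [hc.symm]
  by_cases hx2 : H = 2 ∧ ((Finset.univ.filter fun l => b l = 1).card = 5 ∧
      (Finset.univ.filter fun l => b l = 2).card = 0 ∨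
      (Finset.univ.filter fun l => b l = 1).card = 4 ∧
      (Finset.univ.filter fun l => b l = 2).card = 1 ∨
      (Finset.univ.filter fun l => b l = 1).card = 6 ∧
      (Finset.univ.filter fun l => b l = 2).card = 0)
  · left
    obtain ⟨rfl, hx⟩ := hx2
    have hz : ∀ c, c ≠ 1 → c ≠ 2 → (Finset.univ.filter fun l => b l = c).card = 0 := by
      intro c hc hc'
      by_contra h
      obtain ⟨l, rfl⟩ := hmem c (Nat.pos_of_ne_zero h)
      have := h1 l
      have := hb l
      omega
    have hw : ∀ n t c : ℕ, c ≠ 1 → c ≠ 2 → (Finset.univ.filter fun i : Fin n =>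
        (if (i : ℕ) < t then 2 else 1) = c).card = 0 := by
      intro n t c hc hc'
      rw [Finset.card_eq_zero, Finset.filter_eq_empty_iff]
      intro i _
      split_ifs
      · exact hc'.symm
      · exact hc.symm
    rcases hx with ⟨ha, hd⟩ | ⟨ha, hd⟩ | ⟨ha, hd⟩
    · refine hasOutline_three_twos_five_ones.of_card_eq fun c => ?_
      rcases eq_or_ne c 1 with rfl | hc
      · rw [ha]; rfl
      rcases eq_or_ne c 2 with rfl | hc'
      · rw [hd]; rfl
      rw [hz c hc hc', if_neg hc'.symm, hw _ _ c hc hc']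
    · refine hasOutline_four_twos_four_ones.of_card_eq fun c => ?_
      rcases eq_or_ne c 1 with rfl | hc
      · rw [ha]; rfl
      rcases eq_or_ne c 2 with rfl | hc'
      · rw [hd]; rfl
      rw [hz c hc hc', if_neg hc'.symm, hw _ _ c hc hc']
    · refine hasOutline_three_twos_six_ones.of_card_eq fun c => ?_
      rcases eq_or_ne c 1 with rfl | hc
      · rw [ha]; rfl
      rcases eq_or_ne c 2 with rfl | hc'
      · rw [hd]; rfl
      rw [hz c hc hc', if_neg hc'.symm, hw _ _ c hc hc']
  right
  have hB' : ∑ j, b j = (Finset.univ.filter fun l => b l = 1).card +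
      2 * (Finset.univ.filter fun l => b l = 2).card +
      3 * (Finset.univ.filter fun l => b l = 3).card := by
    omega
  have hcheck := (isSmallEmpty_of_isFewParts H h4
    (Finset.univ.filter fun l => b l = 1).card (by omega)
    (Finset.univ.filter fun l => b l = 2).card (by omega)
    (Finset.univ.filter fun l => b l = 3).card (by omega)).resolve_left
    (not_not_intro ⟨hH, by omega, by omega, by omega, by omega, by omega, hx1, hx2⟩)
  unfold IsSmallEmpty at hcheck
  rw [← hB'] at hcheck
  unfold IsSmallDeficiency
  rw [hsum fun v => v * (3 * H + v - ∑ j, b j),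
    hsum fun v => if 3 * H ∣ v * (3 * H + v - ∑ j, b j) then 0 else 1,
    hsum fun v => v * (3 * H + v - ∑ j, b j) / (3 * H)]
  exact hcheck

/-- Every sequence of parts has an outline if its three largest parts are equal. -/
theorem hasOutline_of_antitone {r H : ℕ} {b : Fin r → ℕ} (hH : 0 < H) (h1 : ∀ l, 1 ≤ b l)
    (hb : ∀ l, b l ≤ H) (hanti : Antitone b) :
    HasOutline (Sum.elim (fun _ : Fin 3 => H) b) := by
  by_cases hfew : ∀ l, ∑ j, b j ≤ 3 * H + b l
  · exact hasOutline_of_few_parts hH h1 hb hfew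
  push Not at hfew
  obtain ⟨l, hl⟩ := hfew
  obtain ⟨i, -, hi⟩ := Finset.exists_min_image Finset.univ b ⟨l, Finset.mem_univ l⟩
  have hmin : ∀ j, b i ≤ b j := fun j => hi j (Finset.mem_univ j)
  have := hmin l
  rcases le_or_gt (∑ j, b j + 6) (6 * H) with h | h
  · exact hasOutline_of_sum_le (h1 i) hb hmin rfl (by omega) h
  · exact hasOutline_of_le_sum (h1 i) hanti hb hmin rfl hH (by omega) (by omega)

/-- if `3 ≤ m ≤ k` and `h_m ≥ h_{m+1} ≥ … ≥ h_k > 0`, then the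
partition consisting of `m` parts equal to `h m` followed by the parts
`h_{m+1}, …, h_k` has a realization.  (Indices are 1-based: the `i`-th part of
the partition, for `i ∈ {1,…,k}`, equals `h m` if `i ≤ m` and `h i` otherwise.) -/
theorem statement0 (m k : ℕ) (h : ℕ → ℕ)
    (hm : 3 ≤ m) (hmk : m ≤ k)
    (hmono : ∀ i, m ≤ i → i < k → h (i + 1) ≤ h i)
    (hpos : ∀ i, m ≤ i → i ≤ k → 0 < h i) :
    HasRealization (fun i : Fin k => if (i : ℕ) + 1 ≤ m then h m else h ((i : ℕ) + 1)) := by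
  obtain ⟨r, rfl⟩ := Nat.exists_eq_add_of_le (hm.trans hmk)
  have hle : ∀ i j, m ≤ i → i ≤ j → j ≤ 3 + r → h j ≤ h i := by
    intro i j hi hij
    induction j, hij using Nat.le_induction with
    | base => exact fun _ => le_rfl
    | succ j hij ih => exact fun hj => (hmono j (by omega) (by omega)).trans (ih (by omega))
  let w : ℕ → ℕ := fun i => if i + 1 ≤ m then h m else h (i + 1)
  have hout : HasOutline (Sum.elim (fun _ : Fin 3 => h m) fun j : Fin r => w (3 + j)) := by
    refine hasOutline_of_antitone (hpos m le_rfl hmk) (fun j => ?_) (fun j => ?_) fun i j hij => ?_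
    · simp only [w]
      split_ifs
      · exact hpos m le_rfl hmk
      · exact hpos _ (by omega) (by omega)
    · simp only [w]
      split_ifs
      · exact le_rfl
      · exact hle _ _ le_rfl (by omega) (by omega)
    · have hij' : (i : ℕ) ≤ j := hij
      simp only [w]
      split_ifs
      · exact le_rfl
      · omega
      · exact hle _ _ le_rfl (by omega) (by omega)
      · exact hle _ _ (by omega) (by omega) (by omega)
  refine (hout.congr finSumFinEquiv.symm fun i => ?_).hasRealization
  induction i using Fin.addCases with
  | left i =>
    rw [finSumFinEquiv_symm_apply_castAdd, Sum.elim_inl, Fin.val_castAdd, if_pos (by omega)]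
  | right j =>
    rw [finSumFinEquiv_symm_apply_natAdd, Sum.elim_inr, Fin.val_natAdd]
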